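/- Let Ω be an open set in ℂⁿ = ℂᵏ × ℂᵐ with m ≥ 2. For every t ∈ [0,1] let Φ_t : Ω → ℂⁿ be an injective holomorphic map of the form Φ_t(z,w) = (z, φ_t(z,w)) for z ∈ ℂᵏ, w ∈ ℂᵐ, such that (t,z,w) ↦ Φ_t(z,w) is of class C¹ on [0,1] × Ω, Φ₀ is the identity on Ω, and the open set Φ_t(Ω) is Runge in ℂⁿ for every t ∈ [0,1]. Then Φ₁ can be approximated uniformly on compact subsets of Ω by holomorphic automorphisms of ℂⁿ of the form Ψ(z,w) = (z, ψ(z,w)): for every compact K ⊆ Ω and ε > 0 there is such an automorphism Ψ with ‖Ψ(z,w) − Φ₁(z,w)‖ < ε for all (z,w) ∈ K. -/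

import Mathlib

noncomputable section

/-- An open set Ω ⊆ ℂᵏ × ℂᵐ = ℂⁿ is Runge if every function holomorphic on Ω can be
approximated uniformly on compact subsets of Ω by polynomials in the n coordinates. -/
def IsRungeProd (k m : ℕ)
    (Ω : Set (EuclideanSpace ℂ (Fin k) × EuclideanSpace ℂ (Fin m))) : Prop :=
  ∀ g : EuclideanSpace ℂ (Fin k) × EuclideanSpace ℂ (Fin m) → ℂ, DifferentiableOn ℂ g Ω →
    ∀ K : Set (EuclideanSpace ℂ (Fin k) × EuclideanSpace ℂ (Fin m)), K ⊆ Ω → IsCompact K →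
      ∀ ε : ℝ, 0 < ε →
        ∃ p : MvPolynomial (Fin k ⊕ Fin m) ℂ,
          ∀ zw ∈ K,
            ‖g zw - MvPolynomial.eval (Sum.elim (fun i => zw.1 i) (fun i => zw.2 i)) p‖ < ε

/-- A holomorphic automorphism of ℂⁿ = ℂᵏ × ℂᵐ. -/
def IsHolomorphicAutomorphismProd {k m : ℕ}
    (F : EuclideanSpace ℂ (Fin k) × EuclideanSpace ℂ (Fin m) →
         EuclideanSpace ℂ (Fin k) × EuclideanSpace ℂ (Fin m)) : Prop :=
  Differentiable ℂ F ∧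
    ∃ G : EuclideanSpace ℂ (Fin k) × EuclideanSpace ℂ (Fin m) →
          EuclideanSpace ℂ (Fin k) × EuclideanSpace ℂ (Fin m),
      Differentiable ℂ G ∧ (∀ z, G (F z) = z) ∧ (∀ z, F (G z) = z)

section

open Filter Topology

lemma IsHolomorphicAutomorphismProd.comp {k m : ℕ}
    {F G : EuclideanSpace ℂ (Fin k) × EuclideanSpace ℂ (Fin m) →
         EuclideanSpace ℂ (Fin k) × EuclideanSpace ℂ (Fin m)}
    (hF : IsHolomorphicAutomorphismProd F) (hG : IsHolomorphicAutomorphismProd G) :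
    IsHolomorphicAutomorphismProd (F ∘ G) := by
  obtain ⟨hF, F', hF', h₁, h₂⟩ := hF
  obtain ⟨hG, G', hG', h₃, h₄⟩ := hG
  exact ⟨hF.comp hG, G' ∘ F', hG'.comp hF', fun z => by simp [h₁, h₃], fun z => by simp [h₂, h₄]⟩

lemma isHolomorphicAutomorphismProd_id {k m : ℕ} :
    IsHolomorphicAutomorphismProd (id : EuclideanSpace ℂ (Fin k) × EuclideanSpace ℂ (Fin m) →
         EuclideanSpace ℂ (Fin k) × EuclideanSpace ℂ (Fin m)) :=
  ⟨differentiable_id, id, differentiable_id, fun _ => rfl, fun _ => rfl⟩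

/-- A holomorphic automorphism of ℂᵏ × ℂᵐ preserving the projection to ℂᵏ. -/
def IsFiberAutomorphism {k m : ℕ}
    (F : EuclideanSpace ℂ (Fin k) × EuclideanSpace ℂ (Fin m) →
         EuclideanSpace ℂ (Fin k) × EuclideanSpace ℂ (Fin m)) : Prop :=
  IsHolomorphicAutomorphismProd F ∧ ∀ zw, (F zw).1 = zw.1

lemma IsFiberAutomorphism.comp {k m : ℕ}
    {F G : EuclideanSpace ℂ (Fin k) × EuclideanSpace ℂ (Fin m) →
         EuclideanSpace ℂ (Fin k) × EuclideanSpace ℂ (Fin m)}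
    (hF : IsFiberAutomorphism F) (hG : IsFiberAutomorphism G) :
    IsFiberAutomorphism (F ∘ G) :=
  ⟨hF.1.comp hG.1, fun zw => by simp [hF.2, hG.2]⟩

/-- `A` is a family of maps agreeing with the flow of the vector field `X` to first order,
uniformly on bounded sets. -/
def IsFirstOrderFlow {E : Type*} [NormedAddCommGroup E] [NormedSpace ℂ E]
    (A : ℂ → E → E) (X : E → E) : Prop :=
  ∀ R : ℝ, ∀ ε : ℝ, 0 < ε → ∃ r : ℝ, 0 < r ∧ ∀ h : ℂ, ‖h‖ < r → ∀ y : E, ‖y‖ ≤ R →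
    ‖A h y - y - h • X y‖ ≤ ε * ‖h‖

lemma IsFirstOrderFlow.comp {E : Type*} [NormedAddCommGroup E] [NormedSpace ℂ E]
    [ProperSpace E] {A B : ℂ → E → E} {X Y : E → E}
    (hA : IsFirstOrderFlow A X) (hB : IsFirstOrderFlow B Y) (hX : Continuous X)
    (hY : Continuous Y) : IsFirstOrderFlow (fun h => A h ∘ B h) (X + Y) := by
  intro R ε hε
  obtain ⟨C, hC⟩ := (isCompact_closedBall (0 : E) R).exists_bound_of_continuousOn hY.continuousOn
  have hu := (isCompact_closedBall (0 : E) (R + 1)).uniformContinuousOn_of_continuous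
    hX.continuousOn
  rw [Metric.uniformContinuousOn_iff] at hu
  obtain ⟨δ, hδ, hu⟩ := hu (ε / 3) (by positivity)
  obtain ⟨r₁, hr₁, hA⟩ := hA (R + 1) (ε / 3) (by positivity)
  obtain ⟨r₂, hr₂, hB⟩ := hB R (ε / 3) (by positivity)
  have hCp : 0 < |C| + ε / 3 := by positivity
  refine ⟨min (min r₁ r₂) (min (1 / (|C| + ε / 3)) (δ / (|C| + ε / 3))),
    by positivity, fun h hh y hy => ?_⟩
  simp only [lt_min_iff] at hh
  obtain ⟨⟨h1, h2⟩, h3, h4⟩ := hh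
  rw [lt_div_iff₀ hCp] at h3 h4
  have hb := hB h h2 y hy
  have hYy : ‖Y y‖ ≤ |C| := (hC y (by simpa using hy)).trans (le_abs_self C)
  have hz : ‖B h y - y‖ ≤ ‖h‖ * (|C| + ε / 3) := by
    calc ‖B h y - y‖ = ‖(B h y - y - h • Y y) + h • Y y‖ := by congr 1; abel
      _ ≤ ε / 3 * ‖h‖ + ‖h‖ * |C| := by
        refine (norm_add_le _ _).trans (add_le_add hb ?_)
        rw [norm_smul]; gcongr
      _ = _ := by ring
  have hzR : ‖B h y‖ ≤ R + 1 := by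
    calc ‖B h y‖ = ‖y + (B h y - y)‖ := by congr 1; abel
      _ ≤ R + 1 := (norm_add_le _ _).trans (by linarith)
  have ha := hA h h1 (B h y) hzR
  have hx : ‖X (B h y) - X y‖ ≤ ε / 3 := by
    rw [← dist_eq_norm]
    refine (hu _ (by simpa using hzR) _ (by simp; linarith) ?_).le
    rw [dist_eq_norm]; linarith
  calc ‖(A h ∘ B h) y - y - h • (X + Y) y‖
      = ‖(A h (B h y) - B h y - h • X (B h y)) + (B h y - y - h • Y y)
          + h • (X (B h y) - X y)‖ := by
        congr 1; simp only [Function.comp, Pi.add_apply, smul_add, smul_sub]; abel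
    _ ≤ ε / 3 * ‖h‖ + ε / 3 * ‖h‖ + ‖h‖ * (ε / 3) := by
        refine (norm_add_le _ _).trans (add_le_add ((norm_add_le _ _).trans (add_le_add ha hb)) ?_)
        rw [norm_smul]; gcongr
    _ = ε * ‖h‖ := by ring

lemma IsFirstOrderFlow.smul {E : Type*} [NormedAddCommGroup E] [NormedSpace ℂ E]
    {A : ℂ → E → E} {X : E → E} (hA : IsFirstOrderFlow A X) (c : ℂ) :
    IsFirstOrderFlow (fun h => A (h * c)) (c • X) := by
  intro R ε hε
  have hc : 0 < ‖c‖ + 1 := by positivity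
  obtain ⟨r, hr, hA⟩ := hA R (ε / (‖c‖ + 1)) (by positivity)
  refine ⟨r / (‖c‖ + 1), by positivity, fun h hh y hy => ?_⟩
  rw [lt_div_iff₀ hc] at hh
  have hn := norm_nonneg h
  have := hA (h * c) (by rw [norm_mul]; nlinarith) y hy
  rw [Pi.smul_apply, smul_smul]
  refine this.trans ?_
  rw [norm_mul, div_mul_eq_mul_div, div_le_iff₀ hc]
  nlinarith [mul_nonneg hε.le hn]

/-- The continuous vector fields on ℂᵏ × ℂᵐ which are tangent to first order to a family of
fibre-preserving holomorphic automorphisms. -/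
def automorphismFields (k m : ℕ) :
    Submodule ℂ (EuclideanSpace ℂ (Fin k) × EuclideanSpace ℂ (Fin m) →
      EuclideanSpace ℂ (Fin k) × EuclideanSpace ℂ (Fin m)) where
  carrier := {X | Continuous X ∧ ∃ A, (∀ h, IsFiberAutomorphism (A h)) ∧ IsFirstOrderFlow A X}
  zero_mem' := ⟨continuous_zero, fun _ => id,
    fun _ => ⟨isHolomorphicAutomorphismProd_id, fun _ => rfl⟩,
    fun _ ε hε => ⟨1, one_pos, fun h _ y _ => by simp; positivity⟩⟩
  add_mem' := by
    rintro X Y ⟨hX, A, hA, hAX⟩ ⟨hY, B, hB, hBY⟩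
    exact ⟨hX.add hY, fun h => A h ∘ B h, fun h => (hA h).comp (hB h), hAX.comp hBY hX hY⟩
  smul_mem' := by
    rintro c X ⟨hX, A, hA, hAX⟩
    exact ⟨hX.const_smul c, fun h => A (h * c), fun h => hA _, hAX.smul c⟩

lemma shear_mem_automorphismFields {k m : ℕ}
    {f : EuclideanSpace ℂ (Fin k) × EuclideanSpace ℂ (Fin m) → ℂ} (hf : Differentiable ℂ f)
    (v : EuclideanSpace ℂ (Fin m)) (hfv : ∀ p (ζ : ℂ), f (p + (0, ζ • v)) = f p) :
    (fun p => f p • ((0 : EuclideanSpace ℂ (Fin k)), v)) ∈ automorphismFields k m := by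
  refine ⟨hf.continuous.smul continuous_const, fun h p => p + (0, (h * f p) • v), fun h => ?_, ?_⟩
  · refine ⟨⟨by fun_prop, fun p => p + (0, (-h * f p) • v), by fun_prop, fun p => ?_, fun p => ?_⟩,
      fun p => by simp⟩
    · simp only [hfv]; ext <;> simp
    · simp only [hfv]; ext <;> simp
  · intro R ε hε
    refine ⟨1, one_pos, fun h _ y _ => ?_⟩
    have : y + ((0 : EuclideanSpace ℂ (Fin k)), (h * f y) • v) - y
        - h • f y • ((0 : EuclideanSpace ℂ (Fin k)), v) = 0 := by
      ext <;> simp [mul_assoc]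
    rw [this, norm_zero]; positivity

lemma overshear_mem_automorphismFields {k m : ℕ}
    {f : EuclideanSpace ℂ (Fin k) × EuclideanSpace ℂ (Fin m) → ℂ} (hf : Differentiable ℂ f)
    (v : EuclideanSpace ℂ (Fin m)) (hfv : ∀ p (ζ : ℂ), f (p + (0, ζ • v)) = f p)
    (μ : EuclideanSpace ℂ (Fin m) →L[ℂ] ℂ) (hμ : μ v = 1) :
    (fun p => (f p * μ p.2) • ((0 : EuclideanSpace ℂ (Fin k)), v)) ∈ automorphismFields k m := by
  have hcont : Continuous fun p : EuclideanSpace ℂ (Fin k) × EuclideanSpace ℂ (Fin m) =>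
      (f p * μ p.2) • ((0 : EuclideanSpace ℂ (Fin k)), v) :=
    (hf.continuous.mul (by fun_prop)).smul continuous_const
  have key : ∀ (h : ℂ) (p : EuclideanSpace ℂ (Fin k) × EuclideanSpace ℂ (Fin m)),
      p + (0, ((Complex.exp (h * f p) - 1) * μ p.2) • v)
        + (0, ((Complex.exp (-h * f p) - 1) *
          μ (p + ((0 : EuclideanSpace ℂ (Fin k)),
            ((Complex.exp (h * f p) - 1) * μ p.2) • v)).2) • v) = p := by
    intro h p
    have hE : Complex.exp (-h * f p) * Complex.exp (h * f p) = 1 := by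
      rw [← Complex.exp_add]; simp
    have hadd : ∀ a b : ℂ, ((0 : EuclideanSpace ℂ (Fin k)), a • v) + (0, b • v)
        = (0, (a + b) • v) := fun a b => by rw [add_smul]; simp
    rw [add_assoc, hadd]
    have : (Complex.exp (h * f p) - 1) * μ p.2 + (Complex.exp (-h * f p) - 1) *
          μ (p + ((0 : EuclideanSpace ℂ (Fin k)),
            ((Complex.exp (h * f p) - 1) * μ p.2) • v)).2 = 0 := by
      simp only [Prod.snd_add, map_add, map_smul, hμ, smul_eq_mul, mul_one]
      linear_combination μ p.2 * hE
    rw [this]; simp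
  refine ⟨hcont, fun h p => p + (0, ((Complex.exp (h * f p) - 1) * μ p.2) • v), fun h => ?_, ?_⟩
  · refine ⟨⟨by fun_prop, fun p => p + (0, ((Complex.exp (-h * f p) - 1) * μ p.2) • v),
      by fun_prop, fun p => ?_, fun p => ?_⟩, fun p => by simp⟩
    · simp only [hfv]
      exact key h p
    · simp only [hfv]
      have := key (-h) p
      rwa [neg_neg] at this
  · intro R ε hε
    obtain ⟨C, hC⟩ := (isCompact_closedBall
      (0 : EuclideanSpace ℂ (Fin k) × EuclideanSpace ℂ (Fin m)) R).exists_bound_of_continuousOn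
        hf.continuous.continuousOn
    obtain ⟨D, hD⟩ := (isCompact_closedBall
      (0 : EuclideanSpace ℂ (Fin k) × EuclideanSpace ℂ (Fin m)) R).exists_bound_of_continuousOn
        (f := fun p => μ p.2 • ((0 : EuclideanSpace ℂ (Fin k)), v)) (by fun_prop)
    have hC1 : 0 < |C| + 1 := by positivity
    have hD1 : 0 < |D| + 1 := by positivity
    refine ⟨min (1 / (|C| + 1)) (ε / ((|C| + 1) ^ 2 * (|D| + 1))), by positivity,
      fun h hh y hy => ?_⟩
    rw [lt_min_iff, lt_div_iff₀ hC1, lt_div_iff₀ (by positivity)] at hh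
    have hfy : ‖f y‖ ≤ |C| + 1 := by
      linarith [hC y (by simpa using hy), le_abs_self C]
    have hDy : ‖μ y.2 • ((0 : EuclideanSpace ℂ (Fin k)), v)‖ ≤ |D| + 1 := by
      linarith [hD y (by simpa using hy), le_abs_self D]
    have hn : ‖h * f y‖ ≤ ‖h‖ * (|C| + 1) := by rw [norm_mul]; gcongr
    have he := Complex.norm_exp_sub_one_sub_id_le (hn.trans hh.1.le)
    have : y + ((0 : EuclideanSpace ℂ (Fin k)), ((Complex.exp (h * f y) - 1) * μ y.2) • v) - y
        - h • (f y * μ y.2) • ((0 : EuclideanSpace ℂ (Fin k)), v)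
        = (Complex.exp (h * f y) - 1 - h * f y) •
          (μ y.2 • ((0 : EuclideanSpace ℂ (Fin k)), v)) := by
      ext <;> simp; ring
    rw [this, norm_smul]
    calc _ ≤ (‖h‖ * (|C| + 1)) ^ 2 * (|D| + 1) := by
          gcongr
          exact he.trans (by gcongr)
      _ = ‖h‖ * (‖h‖ * ((|C| + 1) ^ 2 * (|D| + 1))) := by ring
      _ ≤ ‖h‖ * ε := by gcongr; exact hh.2.le
      _ = ε * ‖h‖ := mul_comm _ _

lemma mem_of_forall_sum_pow_smul_mem {M : Type*} [AddCommGroup M] [Module ℂ M]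
    (S : Submodule ℂ M) (N : ℕ) (v : ℕ → M)
    (h : ∀ s : ℂ, ∑ j ∈ Finset.range N, s ^ j • v j ∈ S) (j : ℕ) (hj : j < N) : v j ∈ S := by
  rw [← Submodule.Quotient.mk_eq_zero, ← Module.forall_dual_apply_eq_zero_iff ℂ]
  intro φ
  set P : Polynomial ℂ := ∑ j ∈ Finset.range N,
    Polynomial.C (φ (Submodule.Quotient.mk (v j))) * Polynomial.X ^ j with hP
  have hP0 : P = 0 := by
    apply Polynomial.funext
    intro s
    have := congrArg φ ((Submodule.Quotient.mk_eq_zero S).2 (h s))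
    rw [← Submodule.mkQ_apply, map_sum, map_sum] at this
    simp only [map_smul, map_zero, Submodule.mkQ_apply, smul_eq_mul] at this
    rw [hP, Polynomial.eval_finsetSum, Polynomial.eval_zero, ← this]
    simp only [Polynomial.eval_mul, Polynomial.eval_C, Polynomial.eval_pow, Polynomial.eval_X]
    exact Finset.sum_congr rfl fun _ _ => mul_comm _ _
  have := congrArg (fun q => Polynomial.coeff q j) hP0
  simpa [hP, Polynomial.finsetSum_coeff, Polynomial.coeff_C_mul, Polynomial.coeff_X_pow, hj]
    using this

lemma sub_mem_of_forall_sum_pow_smul_mem {M : Type*} [AddCommGroup M] [Module ℂ M]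
    (S : Submodule ℂ M) (N : ℕ) (a b : ℕ → M)
    (h : ∀ s : ℂ, ∑ j ∈ Finset.range N, s ^ j • (a j - s • b j) ∈ S)
    (j : ℕ) (hj : j + 1 < N) : a (j + 1) - b j ∈ S := by
  have := mem_of_forall_sum_pow_smul_mem S (N + 1)
    (fun i => (if i < N then a i else 0) - (if i = 0 then 0 else b (i - 1))) (fun s => ?_) (j + 1)
    (by omega)
  · simpa [hj] using this
  · have h1 := h s
    simp only [smul_sub, Finset.sum_sub_distrib] at h1 ⊢
    rw [Finset.sum_range_succ, Finset.sum_range_succ' (fun i => s ^ i • (if i = 0 then 0 else _))]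
    convert h1 using 2
    · simp only [lt_irrefl, if_false, smul_zero, add_zero]
      exact Finset.sum_congr rfl fun i hi => by rw [if_pos (Finset.mem_range.1 hi)]
    · simp [pow_succ, smul_smul]

section PolynomialFlow

variable {k m : ℕ}

/-- The constant vertical vector field in the direction of the `i`-th coordinate of ℂᵐ. -/
def verticalVector (k m : ℕ) (i : Fin m) : EuclideanSpace ℂ (Fin k) × EuclideanSpace ℂ (Fin m) :=
  (0, EuclideanSpace.single i 1)

lemma shear_pair_mem {c : EuclideanSpace ℂ (Fin k) × EuclideanSpace ℂ (Fin m) → ℂ}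
    (hc : Differentiable ℂ c) {i i' : Fin m} (hii : i ≠ i')
    (hi : ∀ p (ζ : ℂ), c (p + ζ • verticalVector k m i) = c p)
    (hi' : ∀ p (ζ : ℂ), c (p + ζ • verticalVector k m i') = c p) (s : ℂ) (d : ℕ) :
    (fun p => (c p * (s * p.2 i + p.2 i') ^ d) •
      (verticalVector k m i - s • verticalVector k m i')) ∈ automorphismFields k m ∧
    (fun p => (c p * (s * p.2 i + p.2 i') ^ d * p.2 i) •
      (verticalVector k m i - s • verticalVector k m i')) ∈ automorphismFields k m := by
  have hv : verticalVector k m i - s • verticalVector k m i' =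
      ((0 : EuclideanSpace ℂ (Fin k)), EuclideanSpace.single i (1 : ℂ)
        - s • EuclideanSpace.single i' (1 : ℂ)) := by
    simp [verticalVector]
  have hd : Differentiable ℂ (fun p : EuclideanSpace ℂ (Fin k) × EuclideanSpace ℂ (Fin m) =>
      c p * (s * p.2 i + p.2 i') ^ d) := by fun_prop
  have hinv : ∀ (p : EuclideanSpace ℂ (Fin k) × EuclideanSpace ℂ (Fin m)) (ζ : ℂ),
      c (p + (0, ζ • (EuclideanSpace.single i (1 : ℂ) - s • EuclideanSpace.single i' (1 : ℂ)))) *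
        (s * (p + ((0 : EuclideanSpace ℂ (Fin k)), ζ • (EuclideanSpace.single i (1 : ℂ)
          - s • EuclideanSpace.single i' (1 : ℂ)))).2 i +
          (p + ((0 : EuclideanSpace ℂ (Fin k)), ζ • (EuclideanSpace.single i (1 : ℂ)
          - s • EuclideanSpace.single i' (1 : ℂ)))).2 i') ^ d
        = c p * (s * p.2 i + p.2 i') ^ d := by
    intro p ζ
    congr 1
    · refine Eq.trans (congrArg c ?_) ((hi' (p + ζ • verticalVector k m i) (-(ζ * s))).trans (hi p ζ))
      ext
      · simp [verticalVector]
      · simp only [verticalVector, Prod.smul_mk, Prod.snd_add, PiLp.add_apply, PiLp.smul_apply,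
          PiLp.sub_apply, smul_eq_mul]
        ring
    · simp [hii, hii.symm]
      ring
  rw [hv]
  refine ⟨shear_mem_automorphismFields hd _ hinv, ?_⟩
  exact overshear_mem_automorphismFields hd _ hinv (EuclideanSpace.proj i) (by simp [hii])

lemma choose_mul_choose_ne (i l : ℕ) :
    ((i + 1 + l).choose i : ℂ) * ((i + 2 + l).choose (i + 2)) -
      ((i + 2 + l).choose (i + 1)) * ((i + 1 + l).choose (i + 1)) ≠ 0 := by
  have h1 := Nat.add_one_mul_choose_eq (i + 1 + l) i
  have h2 := Nat.add_one_mul_choose_eq (i + 1 + l) (i + 1)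
  have e : i + 1 + l + 1 = i + 2 + l := by omega
  rw [e] at h1 h2
  have p1 : 0 < (i + 1 + l).choose i := Nat.choose_pos (by omega)
  have p2 : 0 < (i + 1 + l).choose (i + 1) := Nat.choose_pos (by omega)
  rw [sub_ne_zero]
  norm_cast
  intro h
  have h3 : (i + 2 + l) * (i + 1 + l).choose (i + 1) * (i + 1 + l).choose i * (i + 1) =
      (i + 2 + l) * (i + 1 + l).choose i * (i + 1 + l).choose (i + 1) * (i + 2) := by
    rw [h2, h1]
    linear_combination ((i : ℕ) + 1) * (i + 2) * h
  have h4 : 0 < (i + 2 + l) * ((i + 1 + l).choose (i + 1) * (i + 1 + l).choose i) := by positivity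
  nlinarith

lemma monomial_pair_mem {c : EuclideanSpace ℂ (Fin k) × EuclideanSpace ℂ (Fin m) → ℂ}
    (hc : Differentiable ℂ c) {i i' : Fin m} (hii : i ≠ i')
    (hi : ∀ p (ζ : ℂ), c (p + ζ • verticalVector k m i) = c p)
    (hi' : ∀ p (ζ : ℂ), c (p + ζ • verticalVector k m i') = c p) (a b : ℕ) :
    (fun p => (c p * (p.2 i ^ a * p.2 i' ^ b)) • verticalVector k m i)
      ∈ automorphismFields k m := by
  match a with
  | 0 => simpa using (shear_pair_mem hc hii hi hi' 0 b).1
  | 1 => simpa [mul_assoc, mul_comm, mul_left_comm] using (shear_pair_mem hc hii hi hi' 0 b).2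
  | n + 2 =>
    have hS := sub_mem_of_forall_sum_pow_smul_mem (automorphismFields k m) (n + 2 + b + 1)
      (fun j p => (c p * (((n + 2 + b).choose j : ℂ) * p.2 i ^ j * p.2 i' ^ (n + 2 + b - j))) •
        verticalVector k m i)
      (fun j p => (c p * (((n + 2 + b).choose j : ℂ) * p.2 i ^ j * p.2 i' ^ (n + 2 + b - j))) •
        verticalVector k m i')
      (fun s => by
        convert (shear_pair_mem hc hii hi hi' s (n + 2 + b)).1 using 1
        funext p
        simp only [Finset.sum_apply, Pi.smul_apply, Pi.sub_apply]
        rw [add_pow, Finset.mul_sum, Finset.sum_smul]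
        refine Finset.sum_congr rfl fun j _ => ?_
        module) (n + 1) (by omega)
    have hO := sub_mem_of_forall_sum_pow_smul_mem (automorphismFields k m) (n + 1 + b + 1)
      (fun j p => (c p * (((n + 1 + b).choose j : ℂ) * p.2 i ^ j * p.2 i' ^ (n + 1 + b - j))
        * p.2 i) • verticalVector k m i)
      (fun j p => (c p * (((n + 1 + b).choose j : ℂ) * p.2 i ^ j * p.2 i' ^ (n + 1 + b - j))
        * p.2 i) • verticalVector k m i')
      (fun s => by
        convert (shear_pair_mem hc hii hi hi' s (n + 1 + b)).2 using 1
        funext p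
        simp only [Finset.sum_apply, Pi.smul_apply, Pi.sub_apply]
        rw [add_pow, Finset.mul_sum, Finset.sum_mul, Finset.sum_smul]
        refine Finset.sum_congr rfl fun j _ => ?_
        module) n (by omega)
    have hmem := Submodule.sub_mem _
      (Submodule.smul_mem _ ((n + 1 + b).choose n : ℂ) hS)
      (Submodule.smul_mem _ ((n + 2 + b).choose (n + 1) : ℂ) hO)
    rw [← Submodule.smul_mem_iff _ (choose_mul_choose_ne n b)]
    convert hmem using 1
    funext p
    have e1 : n + 2 + b - (n + 1) = b + 1 := by omega
    have e2 : n + 2 + b - (n + 1 + 1) = b := by omega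
    have e3 : n + 1 + b - (n + 1) = b := by omega
    have e4 : n + 1 + b - n = b + 1 := by omega
    simp only [Pi.smul_apply, Pi.sub_apply, e1, e2, e3, e4]
    module

lemma monomial_mem_automorphismFields (hm : 2 ≤ m) (i : Fin m) (s : (Fin k ⊕ Fin m) →₀ ℕ) (r : ℂ) :
    (fun p : EuclideanSpace ℂ (Fin k) × EuclideanSpace ℂ (Fin m) =>
      MvPolynomial.eval (Sum.elim (fun i => p.1 i) (fun i => p.2 i))
        (MvPolynomial.monomial s r) • verticalVector k m i) ∈ automorphismFields k m := by
  obtain ⟨i', hii⟩ : ∃ i' : Fin m, i ≠ i' := by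
    have : Nontrivial (Fin m) := Fin.nontrivial_iff_two_le.2 hm
    exact (exists_ne i).imp fun _ h => h.symm
  have := monomial_pair_mem (k := k) (m := m) (i := i) (i' := i')
    (c := fun p => r * (∏ j, p.1 j ^ s (Sum.inl j)) *
      ∏ j ∈ (Finset.univ.erase i).erase i', p.2 j ^ s (Sum.inr j))
    (by fun_prop) hii
    (fun p ζ => by
      congr 1
      · simp [verticalVector]
      · refine Finset.prod_congr rfl fun j hj => ?_
        simp only [Finset.mem_erase] at hj
        simp [verticalVector, hj.2.1])
    (fun p ζ => by
      congr 1
      · simp [verticalVector]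
      · refine Finset.prod_congr rfl fun j hj => ?_
        simp only [Finset.mem_erase] at hj
        simp [verticalVector, hj.1])
    (s (Sum.inr i)) (s (Sum.inr i'))
  convert this using 1
  funext p
  rw [MvPolynomial.eval_monomial, Finsupp.prod_fintype _ _ (by simp), Fintype.prod_sum_type]
  simp only [Sum.elim_inl, Sum.elim_inr]
  congr 1
  rw [← Finset.mul_prod_erase Finset.univ _ (Finset.mem_univ i),
    ← Finset.mul_prod_erase (Finset.univ.erase i) (fun j => p.2 j ^ s (Sum.inr j))
      (a := i') (by simp [hii.symm])]
  ring

/-- For `2 ≤ m`, polynomial vertical vector fields are tangent to fibre-preserving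
automorphisms. -/
lemma polynomial_mem_automorphismFields (hm : 2 ≤ m)
    (P : Fin m → MvPolynomial (Fin k ⊕ Fin m) ℂ) :
    (fun p : EuclideanSpace ℂ (Fin k) × EuclideanSpace ℂ (Fin m) =>
      ∑ i, MvPolynomial.eval (Sum.elim (fun i => p.1 i) (fun i => p.2 i)) (P i) •
        verticalVector k m i) ∈ automorphismFields k m := by
  have hfun : ∀ (ι : Type) (t : Finset ι)
      (f : ι → EuclideanSpace ℂ (Fin k) × EuclideanSpace ℂ (Fin m) →
        EuclideanSpace ℂ (Fin k) × EuclideanSpace ℂ (Fin m)),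
      (∀ j ∈ t, f j ∈ automorphismFields k m) →
        (fun p => ∑ j ∈ t, f j p) ∈ automorphismFields k m := by
    intro ι t f hf
    convert Submodule.sum_mem _ hf using 1
    funext p
    simp
  refine hfun _ _ _ fun i _ => ?_
  induction P i using MvPolynomial.induction_on' with
  | monomial s r => exact monomial_mem_automorphismFields hm i s r
  | add p q hp hq =>
    simp only [map_add, add_smul]
    exact Submodule.add_mem _ hp hq

end PolynomialFlow

section SeveralVariables

variable {E F : Type*} [NormedAddCommGroup E] [NormedSpace ℂ E] [NormedAddCommGroup F]
  [NormedSpace ℂ F]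

lemma norm_fderiv_le_of_forall_mem_ball_norm_le {f : E → F} {c : E} {R M : ℝ} (hR : 0 < R)
    (hf : DifferentiableOn ℂ f (Metric.ball c R)) (hM : ∀ x ∈ Metric.ball c R, ‖f x‖ ≤ M) :
    ‖fderiv ℂ f c‖ ≤ 2 * M / R := by
  refine Complex.norm_fderiv_le_div_of_mapsTo_ball hf (fun x hx => ?_) hR
  rw [Metric.mem_closedBall, dist_eq_norm]
  linarith [norm_sub_le (f x) (f c), hM x hx, hM c (Metric.mem_ball_self hR)]

lemma norm_sub_sub_fderiv_le {f : E → F} {c z : E} {R M : ℝ}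
    (hf : DifferentiableOn ℂ f (Metric.ball c R)) (hM : ∀ x ∈ Metric.ball c R, ‖f x‖ ≤ M)
    (hz : z ∈ Metric.ball c R) :
    ‖f z - f c - fderiv ℂ f c (z - c)‖ ≤ 4 * M * (‖z - c‖ / R) ^ 2 := by
  have hR : 0 < R := Metric.nonempty_ball.1 ⟨_, hz⟩
  have hc := Metric.mem_ball_self (x := c) hR
  have hd := (hf.differentiableAt (Metric.ball_mem_nhds c hR)).hasFDerivAt
  have key := Complex.dist_le_mul_div_pow_of_mapsTo_ball_of_isLittleO (n := 1)
    (f := fun x => f x - fderiv ℂ f c (x - c)) (c := c) (z := z) (R₁ := R) (R₂ := 4 * M)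
    (hf.sub (by fun_prop)) (fun x hx => ?_) ?_ hz
  · simp only [sub_self, map_zero, sub_zero, dist_eq_norm] at key
    rwa [sub_right_comm] at key
  · simp only [sub_self, map_zero, sub_zero, Metric.mem_closedBall, dist_eq_norm]
    have h1 := norm_fderiv_le_of_forall_mem_ball_norm_le hR hf hM
    have h2 : ‖fderiv ℂ f c (x - c)‖ ≤ 2 * M := by
      have hx' : ‖x - c‖ ≤ R := by rw [← dist_eq_norm]; exact (Metric.mem_ball.1 hx).le
      calc _ ≤ ‖fderiv ℂ f c‖ * ‖x - c‖ := ContinuousLinearMap.le_opNorm _ _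
        _ ≤ 2 * M / R * R := by
          have := (norm_nonneg _).trans h1
          gcongr
        _ = 2 * M := by field_simp
    linarith [norm_sub_le (f x - fderiv ℂ f c (x - c)) (f c), hM x hx, hM c hc,
      norm_sub_le (f x) (fderiv ℂ f c (x - c))]
  · have := hd.isLittleO.norm_right
    simp only [sub_self, map_zero, sub_zero, pow_one]
    refine this.congr_left fun x => ?_
    abel

lemma differentiableAt_of_tendstoUniformlyOn_ball [CompleteSpace F] {ι : Type*} {l : Filter ι}
    [l.NeBot] {f : ι → E → F} {g : E → F} {x : E} {r : ℝ} (hr : 0 < r)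
    (hf : ∀ n, DifferentiableOn ℂ (f n) (Metric.ball x r))
    (h : TendstoUniformlyOn f g l (Metric.ball x r)) : DifferentiableAt ℂ g x := by
  have hsub : ∀ y ∈ Metric.ball x (r / 2), Metric.ball y (r / 2) ⊆ Metric.ball x r :=
    fun y hy => Metric.ball_subset_ball' (by linarith [Metric.mem_ball.1 hy])
  have hC : UniformCauchySeqOn (fun n => fderiv ℂ (f n)) l (Metric.ball x (r / 2)) := by
    intro u hu
    obtain ⟨ε, hε, hu⟩ := Metric.mem_uniformity_dist.1 hu
    filter_upwards [h.uniformCauchySeqOn _ (Metric.dist_mem_uniformity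
      (show 0 < ε * r / 8 by positivity))] with p hp y hy
    apply hu
    have hd : ∀ n, DifferentiableAt ℂ (f n) y := fun n =>
      (hf n).differentiableAt (Metric.isOpen_ball.mem_nhds
        (hsub y hy (Metric.mem_ball_self (by positivity))))
    rw [dist_eq_norm, ← fderiv_sub (hd _) (hd _)]
    have := norm_fderiv_le_of_forall_mem_ball_norm_le (c := y) (half_pos hr)
      (f := f p.1 - f p.2) (M := ε * r / 8)
      (((hf p.1).sub (hf p.2)).mono (hsub y hy)) (fun z hz => by
        rw [Pi.sub_apply, ← dist_eq_norm]; exact (hp z (hsub y hy hz)).le)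
    refine this.trans_lt ?_
    rw [div_lt_iff₀ (by positivity)]
    nlinarith [mul_pos hε hr]
  have hlim : ∀ y, ∃ L, y ∈ Metric.ball x (r / 2) →
      Tendsto (fun n => fderiv ℂ (f n) y) l (𝓝 L) := by
    intro y
    by_cases hy : y ∈ Metric.ball x (r / 2)
    · obtain ⟨L, hL⟩ := cauchy_map_iff_exists_tendsto.1 (hC.cauchy_map hy)
      exact ⟨L, fun _ => hL⟩
    · exact ⟨0, fun h => absurd h hy⟩
  choose g' hg' using hlim
  have hs : Metric.ball x (r / 2) ⊆ Metric.ball x r := Metric.ball_subset_ball (by linarith)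
  refine (hasFDerivAt_of_tendstoUniformlyOn Metric.isOpen_ball
    (hC.tendstoUniformlyOn_of_tendsto hg') (fun n y hy => ?_)
    (fun y hy => h.tendsto_at (hs hy)) (Metric.mem_ball_self (half_pos hr))).differentiableAt
  exact ((hf n).differentiableAt (Metric.isOpen_ball.mem_nhds (hs hy))).hasFDerivAt

lemma differentiableOn_fderiv_apply [CompleteSpace F] {f : E → F} {U : Set E} (hU : IsOpen U)
    (hf : DifferentiableOn ℂ f U) (v : E) : DifferentiableOn ℂ (fun x => fderiv ℂ f x v) U := by
  intro x hx
  obtain ⟨r, hr, hrU, hM⟩ : ∃ r > 0, Metric.ball x r ⊆ U ∧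
      ∀ y ∈ Metric.ball x r, ‖f y‖ ≤ ‖f x‖ + 1 := by
    have hc := (hf.continuousOn.continuousAt (hU.mem_nhds hx)).norm.eventually_lt
      (continuousAt_const (y := ‖f x‖ + 1)) (by linarith)
    obtain ⟨r, hr, h⟩ := Metric.mem_nhds_iff.1 (inter_mem hc (hU.mem_nhds hx))
    exact ⟨r, hr, fun y hy => (h hy).2, fun y hy => (h hy).1.le⟩
  set δ : ℝ := r / (2 * (‖v‖ + 1)) with hδ
  have hδ0 : 0 < δ := by positivity
  set s : ℕ → ℝ := fun n => δ / (n + 1) with hs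
  have hs0 : ∀ n, 0 < s n := fun n => by positivity
  have hsv : ∀ n, ‖(s n : ℂ) • v‖ < r / 2 := by
    intro n
    rw [norm_smul, Complex.norm_real, Real.norm_of_nonneg (hs0 n).le]
    have h1 : s n ≤ δ := div_le_self hδ0.le (by linarith [n.cast_nonneg (α := ℝ)])
    calc s n * ‖v‖ ≤ δ * ‖v‖ := by gcongr
      _ < δ * (‖v‖ + 1) := by gcongr; linarith
      _ = r / 2 := by rw [hδ]; field_simp
  have hmem : ∀ n, ∀ y ∈ Metric.ball x (r / 2), y + (s n : ℂ) • v ∈ Metric.ball x r := by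
    intro n y hy
    rw [Metric.mem_ball, dist_eq_norm] at hy ⊢
    calc _ = ‖(y - x) + (s n : ℂ) • v‖ := by congr 1; abel
      _ < r := (norm_add_le _ _).trans_lt (by linarith [hsv n])
  have hsub : Metric.ball x (r / 2) ⊆ Metric.ball x r := Metric.ball_subset_ball (by linarith)
  refine (differentiableAt_of_tendstoUniformlyOn_ball (l := atTop) (half_pos hr)
    (f := fun n y => (s n : ℂ)⁻¹ • (f (y + (s n : ℂ) • v) - f y)) (fun n => ?_)
    ?_).differentiableWithinAt
  · refine DifferentiableOn.const_smul (.sub ?_ (hf.mono (hsub.trans hrU))) _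
    exact hf.comp (by fun_prop) fun y hy => hrU (hmem n y hy)
  · rw [Metric.tendstoUniformlyOn_iff]
    intro ε hε
    have hlim : Tendsto (fun n => 4 * (‖f x‖ + 1) * (‖v‖ / (r / 2)) ^ 2 * s n) atTop (𝓝 0) := by
      have : Tendsto s atTop (𝓝 0) := by
        simpa [hs, div_eq_mul_inv] using
          (tendsto_one_div_add_atTop_nhds_zero_nat (𝕜 := ℝ)).const_mul δ
      simpa using this.const_mul _
    filter_upwards [hlim.eventually_lt_const hε] with n hn y hy
    refine lt_of_le_of_lt ?_ hn
    have hyb : Metric.ball y (r / 2) ⊆ Metric.ball x r :=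
      Metric.ball_subset_ball' (by linarith [Metric.mem_ball.1 hy])
    have key := norm_sub_sub_fderiv_le (z := y + (s n : ℂ) • v)
      (hf.mono (hyb.trans hrU)) (fun z hz => hM z (hyb hz))
      (by simpa [dist_eq_norm] using hsv n)
    rw [add_sub_cancel_left, map_smul, norm_smul, Complex.norm_real,
      Real.norm_of_nonneg (hs0 n).le] at key
    have hne : (s n : ℂ) ≠ 0 := by exact_mod_cast (hs0 n).ne'
    rw [dist_eq_norm, ← norm_neg, show -(fderiv ℂ f y v -
        (s n : ℂ)⁻¹ • (f (y + (s n : ℂ) • v) - f y)) = (s n : ℂ)⁻¹ •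
          (f (y + (s n : ℂ) • v) - f y - (s n : ℂ) • fderiv ℂ f y v) by
      rw [smul_sub (s n : ℂ)⁻¹ (f _ - f y) _, smul_smul, inv_mul_cancel₀ hne, one_smul]; abel,
      norm_smul, norm_inv, Complex.norm_real, Real.norm_of_nonneg (hs0 n).le,
      inv_mul_le_iff₀ (hs0 n)]
    refine key.trans_eq ?_
    ring

lemma contDiffAt_one_of_differentiableOn [FiniteDimensional ℂ E] [CompleteSpace F] {f : E → F}
    {U : Set E} (hU : IsOpen U) (hf : DifferentiableOn ℂ f U) {x : E} (hx : x ∈ U) :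
    ContDiffAt ℂ 1 f x := by
  have : ContDiffOn ℂ (0 + 1) f U := by
    rw [contDiffOn_succ_iff_fderiv_of_isOpen hU]
    refine ⟨hf, by simp, ?_⟩
    rw [contDiffOn_zero, continuousOn_clm_apply]
    exact fun v => (differentiableOn_fderiv_apply hU hf v).continuousOn
  rw [zero_add] at this
  exact this.contDiffAt (hU.mem_nhds hx)

end SeveralVariables

section Osgood

lemma deriv_ne_zero_of_injOn {f : ℂ → ℂ} {U : Set ℂ} (hU : IsOpen U)
    (hf : DifferentiableOn ℂ f U) (hinj : Set.InjOn f U) {a : ℂ} (ha : a ∈ U) :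
    deriv f a ≠ 0 := by
  have han : ∀ x ∈ U, AnalyticAt ℂ f x := fun x hx => hf.analyticAt (hU.mem_nhds hx)
  have hopen : ∀ x ∈ U, 𝓝 (f x) ≤ map f (𝓝 x) := by
    intro x hx
    refine (han x hx).eventually_constant_or_nhds_le_map_nhds.resolve_left fun h => ?_
    have h2 : ∀ᶠ z in 𝓝[≠] x, z = x := by
      filter_upwards [nhdsWithin_le_nhds h, nhdsWithin_le_nhds (hU.mem_nhds hx)] with z hz hzU
      exact hinj hzU hx hz
    obtain ⟨z, hz, hz'⟩ := (h2.and self_mem_nhdsWithin).exists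
    exact hz' hz
  set G := Function.invFunOn f U with hG
  have hGf : ∀ x ∈ U, G (f x) = x := fun x hx => hinj.leftInvOn_invFunOn hx
  have hGt : ∀ x ∈ U, Tendsto G (𝓝 (f x)) (𝓝 x) := by
    intro x hx
    refine (show Tendsto G (map f (𝓝 x)) (𝓝 x) from ?_).mono_left (hopen x hx)
    rw [tendsto_map'_iff]
    refine tendsto_id.congr' ?_
    filter_upwards [hU.mem_nhds hx] with y hy using (hGf y hy).symm
  have hfG : ∀ x ∈ U, ∀ᶠ y in 𝓝 (f x), f (G y) = y := fun x hx => hopen x hx (by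
    rw [mem_map]
    filter_upwards [hU.mem_nhds hx] with y hy
    simp only [Set.mem_preimage, Set.mem_ofPred_eq, hGf y hy])
  have hGd : ∀ x ∈ U, deriv f x ≠ 0 → DifferentiableAt ℂ G (f x) := by
    intro x hx hx0
    refine (HasDerivAt.of_local_left_inverse (f := f) (f' := deriv f x) ?_ ?_ hx0
      (hfG x hx)).differentiableAt
    · rw [ContinuousAt, hGf x hx]; exact hGt x hx
    · rw [hGf x hx]; exact (han x hx).differentiableAt.hasDerivAt
  have hd : AnalyticAt ℂ (deriv f) a := (han a ha).deriv
  have hGa : DifferentiableAt ℂ G (f a) := by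
    rcases hd.eventually_eq_zero_or_eventually_ne_zero with h | h
    · exfalso
      obtain ⟨r, hr, hrs⟩ := Metric.mem_nhds_iff.1 (inter_mem h (hU.mem_nhds ha))
      have hconst : ∀ x ∈ Metric.ball a r, f x = f a := fun x hx =>
        Metric.isOpen_ball.is_const_of_deriv_eq_zero (convex_ball a r).isPreconnected
          (hf.mono fun y hy => (hrs hy).2) (fun y hy => (hrs hy).1) hx (Metric.mem_ball_self hr)
      have h2 : ∀ᶠ z in 𝓝[≠] a, z = a := by
        filter_upwards [nhdsWithin_le_nhds (Metric.ball_mem_nhds a hr)] with z hz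
        exact hinj (hrs hz).2 ha (hconst z hz)
      obtain ⟨z, hz, hz'⟩ := (h2.and self_mem_nhdsWithin).exists
      exact hz' hz
    · refine (Complex.analyticAt_of_differentiable_on_punctured_nhds_of_continuousAt ?_
        ?_).differentiableAt
      · rw [eventually_nhdsWithin_iff] at h ⊢
        refine hopen a ha (mem_map.2 ?_)
        filter_upwards [h, hU.mem_nhds ha] with x hx hxU hne
        exact hGd x hxU (hx fun h => hne (by rw [Set.mem_singleton_iff.1 h]; rfl))
      · rw [ContinuousAt, hGf a ha]; exact hGt a ha
  intro h0
  have hcomp : HasDerivAt (G ∘ f) (deriv G (f a) * deriv f a) a :=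
    hGa.hasDerivAt.comp a (han a ha).differentiableAt.hasDerivAt
  have hid : HasDerivAt (G ∘ f) 1 a := (hasDerivAt_id a).congr_of_eventuallyEq (by
    filter_upwards [hU.mem_nhds ha] with y hy using hGf y hy)
  have := hcomp.unique hid
  simp [h0] at this

variable {E : Type*} [NormedAddCommGroup E] [NormedSpace ℂ E]

lemma eventually_exists_zero_on_line {h : E → ℂ} {U : Set E} (hU : IsOpen U)
    (hh : DifferentiableOn ℂ h U) {p v : E} (hp : p ∈ U) (hp0 : h p = 0)
    (hne : ¬ ∀ᶠ ζ : ℂ in 𝓝 0, h (p + ζ • v) = 0) {r : ℝ} (hr : 0 < r) :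
    ∀ᶠ q in 𝓝 p, ∃ ζ : ℂ, ‖ζ‖ ≤ r ∧ h (q + ζ • v) = 0 := by
  have hcont : Continuous fun x : E × ℂ => x.1 + x.2 • v := by fun_prop
  have han : AnalyticAt ℂ (fun ζ : ℂ => h (p + ζ • v)) 0 := by
    refine DifferentiableOn.analyticAt (s := (fun ζ : ℂ => p + ζ • v) ⁻¹' U)
      (hh.comp (by fun_prop) fun ζ hζ => hζ) ?_
    exact (hU.preimage (by fun_prop)).mem_nhds (by simpa using hp)
  have hnz := han.eventually_eq_zero_or_eventually_ne_zero.resolve_left hne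
  rw [eventually_nhdsWithin_iff] at hnz
  have hUe : ∀ᶠ ζ : ℂ in 𝓝 0, p + ζ • v ∈ U :=
    (hU.preimage (show Continuous fun ζ : ℂ => p + ζ • v by fun_prop)).mem_nhds
      (by simpa using hp)
  obtain ⟨ρ, hρ, hρs⟩ := Metric.nhds_basis_closedBall.mem_iff.1 (inter_mem hnz hUe)
  set s := min ρ r
  have hs : 0 < s := lt_min hρ hr
  have hsρ : Metric.closedBall (0 : ℂ) s ⊆ Metric.closedBall 0 ρ :=
    Metric.closedBall_subset_closedBall (min_le_left _ _)
  have hUp : ∀ ζ ∈ Metric.closedBall (0 : ℂ) s, p + ζ • v ∈ U := fun ζ hζ => (hρs (hsρ hζ)).2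
  have hnz' : ∀ ζ ∈ Metric.sphere (0 : ℂ) s, h (p + ζ • v) ≠ 0 := fun ζ hζ =>
    (hρs (hsρ (Metric.sphere_subset_closedBall hζ))).1 (ne_of_mem_of_not_mem hζ (by simp [hs.ne]))
  obtain ⟨c, hc, hcs⟩ : ∃ c > 0, ∀ ζ ∈ Metric.sphere (0 : ℂ) s, c < ‖h (p + ζ • v)‖ := by
    have hco : ContinuousOn (fun ζ : ℂ => ‖h (p + ζ • v)‖) (Metric.sphere (0 : ℂ) s) :=
      (hh.continuousOn.comp (by fun_prop)
        fun ζ hζ => hUp ζ (Metric.sphere_subset_closedBall hζ)).norm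
    obtain ⟨ζ₀, hζ₀, hmin⟩ := (isCompact_sphere (0 : ℂ) s).exists_isMinOn
      (NormedSpace.sphere_nonempty.2 hs.le) hco
    refine ⟨‖h (p + ζ₀ • v)‖ / 2, half_pos (norm_pos_iff.2 (hnz' _ hζ₀)), fun ζ hζ => ?_⟩
    have := half_lt_self (norm_pos_iff.2 (hnz' _ hζ₀))
    exact this.trans_le (hmin hζ)
  have hev1 : ∀ᶠ q in 𝓝 p, ∀ ζ ∈ Metric.closedBall (0 : ℂ) s, q + ζ • v ∈ U := by
    refine (isCompact_closedBall (0 : ℂ) s).eventually_forall_of_forall_eventually fun ζ hζ => ?_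
    exact hcont.continuousAt.eventually (hU.mem_nhds (hUp ζ hζ))
  have hev2 : ∀ᶠ q in 𝓝 p, ∀ ζ ∈ Metric.sphere (0 : ℂ) s, c < ‖h (q + ζ • v)‖ := by
    refine (isCompact_sphere (0 : ℂ) s).eventually_forall_of_forall_eventually fun ζ hζ => ?_
    have h1 : ContinuousAt (fun x : E × ℂ => ‖h (x.1 + x.2 • v)‖) (p, ζ) :=
      (ContinuousAt.comp (g := h) (f := fun x : E × ℂ => x.1 + x.2 • v) (hh.continuousOn.continuousAt
        (hU.mem_nhds (hUp ζ (Metric.sphere_subset_closedBall hζ)))) hcont.continuousAt).norm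
    exact h1.eventually (lt_mem_nhds (hcs ζ hζ))
  have hev3 : ∀ᶠ q in 𝓝 p, ‖h q‖ < c := by
    have h1 : ContinuousAt (fun q => ‖h q‖) p := (hh.continuousOn.continuousAt (hU.mem_nhds hp)).norm
    exact h1.eventually (gt_mem_nhds (by simpa [hp0] using hc))
  filter_upwards [hev1, hev2, hev3] with q h1 h2 h3
  by_contra! hno
  have hno' : ∀ ζ ∈ Metric.closedBall (0 : ℂ) s, h (q + ζ • v) ≠ 0 := fun ζ hζ =>
    hno ζ ((mem_closedBall_zero_iff.1 hζ).trans (min_le_right _ _))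
  have hdiff : DifferentiableOn ℂ (fun ζ : ℂ => (h (q + ζ • v))⁻¹) (Metric.closedBall 0 s) :=
    DifferentiableOn.fun_inv (hh.comp (by fun_prop) h1) hno'
  have := Complex.norm_le_of_forall_mem_frontier_norm_le (z := 0) (C := c⁻¹)
    (Metric.isBounded_ball (x := (0 : ℂ)) (r := s)) (hdiff.diffContOnCl_ball subset_rfl)
    (fun ζ hζ => ?_) (subset_closure (Metric.mem_ball_self hs))
  · simp only [zero_smul, add_zero, norm_inv] at this
    have hq0 : 0 < ‖h q‖ := norm_pos_iff.2 (by simpa using hno' 0 (Metric.mem_closedBall_self hs.le))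
    exact absurd ((inv_le_inv₀ hq0 hc).1 this) (not_le.2 h3)
  · rw [frontier_ball _ hs.ne'] at hζ
    rw [norm_inv]
    exact inv_anti₀ hc (h2 ζ hζ).le

lemma exists_fderiv_ne_zero_of_zero_set {h : E → ℂ} {a : E} {ρ : ℝ}
    (hh : DifferentiableOn ℂ h (Metric.ball a ρ)) (ha : h a = 0) {b : E}
    (hb : b ∈ Metric.ball a ρ) (hb0 : h b ≠ 0) :
    ∃ g : E → ℂ, DifferentiableOn ℂ g (Metric.ball a ρ) ∧
      (∀ x ∈ Metric.ball a ρ, h x = 0 → g x = 0) ∧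
      ∃ p ∈ Metric.ball a ρ, h p = 0 ∧ fderiv ℂ g p ≠ 0 := by
  by_contra! hcon
  set v := b - a with hv
  have hv0 : 0 < ‖v‖ := norm_pos_iff.2 (sub_ne_zero.2 fun h => hb0 (h ▸ ha))
  have hbρ : ‖v‖ < ρ := by rw [hv, ← dist_eq_norm]; exact hb
  have hρ : 0 < ρ := hv0.trans hbρ
  set D : (E → ℂ) → E → ℂ := fun g x => fderiv ℂ g x v with hD
  have key : ∀ j : ℕ, DifferentiableOn ℂ (D^[j] h) (Metric.ball a ρ) ∧
      ∀ x ∈ Metric.ball a ρ, h x = 0 → (D^[j] h) x = 0 := by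
    intro j
    induction j with
    | zero => exact ⟨hh, fun x _ hx => hx⟩
    | succ j ih =>
      rw [Function.iterate_succ_apply']
      refine ⟨differentiableOn_fderiv_apply Metric.isOpen_ball ih.1 v, fun x hx hx0 => ?_⟩
      change fderiv ℂ (D^[j] h) x v = 0
      rw [hcon _ ih.1 ih.2 x hx hx0, zero_apply]
  set φ : ℂ → ℂ := fun ζ => h (a + ζ • v)
  set R := ρ / ‖v‖ with hR
  have hmem : ∀ ζ ∈ Metric.ball (0 : ℂ) R, a + ζ • v ∈ Metric.ball a ρ := by
    intro ζ hζ
    rw [mem_ball_zero_iff, hR, lt_div_iff₀ hv0] at hζ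
    simpa [dist_eq_norm, norm_smul] using hζ
  have hiter : ∀ j : ℕ, ∀ ζ ∈ Metric.ball (0 : ℂ) R,
      iteratedDeriv j φ ζ = (D^[j] h) (a + ζ • v) := by
    intro j
    induction j with
    | zero => simp [φ]
    | succ j ih =>
      intro ζ hζ
      rw [iteratedDeriv_succ, Function.iterate_succ_apply']
      have he : iteratedDeriv j φ =ᶠ[𝓝 ζ] fun ζ => (D^[j] h) (a + ζ • v) := by
        filter_upwards [Metric.isOpen_ball.mem_nhds hζ] with z hz using ih z hz
      rw [he.deriv_eq]
      have h1 := ((key j).1.differentiableAt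
        (Metric.isOpen_ball.mem_nhds (hmem ζ hζ))).hasFDerivAt
      have h2 : HasDerivAt (fun ζ : ℂ => a + ζ • v) v ζ := by
        simpa using ((hasDerivAt_id ζ).smul_const v).const_add a
      exact (h1.comp_hasDerivAt ζ h2).deriv
  have hφd : DifferentiableOn ℂ φ (Metric.ball 0 R) := hh.comp (by fun_prop) hmem
  have h1R : (1 : ℂ) ∈ Metric.ball (0 : ℂ) R := by
    rw [mem_ball_zero_iff, hR, norm_one, one_lt_div hv0]; exact hbρ
  have hsum := Complex.taylorSeries_eq_on_ball hφd h1R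
  have hz : ∀ n : ℕ, iteratedDeriv n φ 0 = 0 := by
    intro n
    rw [hiter n 0 (Metric.mem_ball_self (by positivity)), zero_smul, add_zero]
    exact (key n).2 a (Metric.mem_ball_self hρ) ha
  apply hb0
  simpa [hz, φ, v] using hsum.symm

lemma not_injOn_of_fderiv_eq_zero_on_zero_set [FiniteDimensional ℂ E]
    (hE : 2 ≤ Module.finrank ℂ E) {F : E → E} {g h : E → ℂ} {U : Set E}
    (hU : IsOpen U) (hF : DifferentiableOn ℂ F U) (hg : DifferentiableOn ℂ g U)
    (hh : DifferentiableOn ℂ h U) (hgh : ∀ x ∈ U, h x = 0 → g x = 0)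
    (hFh : ∀ x ∈ U, h x = 0 → fderiv ℂ F x = 0) {p : E} (hp : p ∈ U) (hp0 : h p = 0)
    (hgp : fderiv ℂ g p ≠ 0) : ¬ Set.InjOn F U := by
  intro hinj
  set l := fderiv ℂ g p with hl
  obtain ⟨v, hv⟩ : ∃ v, l v = 1 := by
    obtain ⟨w, hw⟩ : ∃ w, l w ≠ 0 := by
      by_contra! hc
      exact hgp (ContinuousLinearMap.ext hc)
    exact ⟨(l w)⁻¹ • w, by simp [hw]⟩
  have hgd : HasStrictFDerivAt g l p :=
    (contDiffAt_one_of_differentiableOn hU hg hp).hasStrictFDerivAt (by norm_num)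
  have hne : ¬ ∀ᶠ ζ : ℂ in 𝓝 0, h (p + ζ • v) = 0 := by
    intro hev
    have h2 : HasDerivAt (fun ζ : ℂ => p + ζ • v) v 0 := by
      simpa using ((hasDerivAt_id (0 : ℂ)).smul_const v).const_add p
    have h1 : HasDerivAt (fun ζ : ℂ => g (p + ζ • v)) (l v) 0 :=
      HasFDerivAt.comp_hasDerivAt (l := g) 0 (by simpa using hgd.hasFDerivAt) h2
    have h3 : HasDerivAt (fun ζ : ℂ => g (p + ζ • v)) 0 0 := by
      refine (hasDerivAt_const (0 : ℂ) (0 : ℂ)).congr_of_eventuallyEq ?_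
      have hUe : ∀ᶠ ζ : ℂ in 𝓝 0, p + ζ • v ∈ U :=
        (hU.preimage (show Continuous fun ζ : ℂ => p + ζ • v by fun_prop)).mem_nhds
          (by simpa using hp)
      filter_upwards [hev, hUe] with ζ hζ hζU using hgh _ hζU hζ
    have := h1.unique h3
    simp [hv] at this
  set c : NNReal := ⟨1 / (2 * (‖v‖ + 1)), by positivity⟩ with hc
  have hc0 : (c : ℝ) = 1 / (2 * (‖v‖ + 1)) := rfl
  obtain ⟨s, hs, hsapp⟩ := hgd.approximates_deriv_on_nhds (c := c)
    (Or.inr (by rw [← NNReal.coe_pos, hc0]; positivity))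
  obtain ⟨δ, hδ, hδs⟩ := Metric.mem_nhds_iff.1 (inter_mem hs (hU.mem_nhds hp))
  set r := δ / (2 * (‖v‖ + 1)) with hr
  have hr0 : 0 < r := by positivity
  obtain ⟨δ', hδ', hδ's⟩ := Metric.mem_nhds_iff.1
    (eventually_exists_zero_on_line hU hh hp hp0 hne hr0)
  set N := LinearMap.ker (l : E →ₗ[ℂ] ℂ) with hN
  have hlN : ∀ q : N, l q = 0 := fun q => q.2
  set d := min δ' (δ / 2) with hd
  have hd0 : 0 < d := lt_min hδ' (half_pos hδ)
  have hex : ∀ q : N, ∃ ζ : ℂ, q ∈ Metric.ball (0 : N) d → ‖ζ‖ ≤ r ∧ h (p + q + ζ • v) = 0 := by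
    intro q
    by_cases hq : q ∈ Metric.ball (0 : N) d
    · have : p + (q : E) ∈ Metric.ball p δ' := by
        rw [mem_ball_zero_iff] at hq
        simpa [dist_eq_norm] using hq.trans_le (min_le_left _ _)
      obtain ⟨ζ, hζ⟩ := hδ's this
      exact ⟨ζ, fun _ => hζ⟩
    · exact ⟨0, fun h => absurd h hq⟩
  choose ζ hζ using hex
  set P : N → E := fun q => p + q + ζ q • v with hP
  have hPmem : ∀ q ∈ Metric.ball (0 : N) d, P q ∈ Metric.ball p δ := by
    intro q hq
    have h1 := (hζ q hq).1
    rw [mem_ball_zero_iff] at hq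
    have h2 : ‖(q : E)‖ < δ / 2 := hq.trans_le (min_le_right _ _)
    rw [Metric.mem_ball, dist_eq_norm, show P q - p = q + ζ q • v by simp only [hP]; abel]
    calc _ ≤ ‖(q : E)‖ + ‖ζ q‖ * ‖v‖ := (norm_add_le _ _).trans_eq (by rw [norm_smul])
      _ < δ / 2 + r * (‖v‖ + 1) := by
        refine add_lt_add_of_lt_of_le h2 ?_
        gcongr
        linarith
      _ = δ := by rw [hr]; field_simp; norm_num
  have hP0 : ∀ q ∈ Metric.ball (0 : N) d, h (P q) = 0 := fun q hq => (hζ q hq).2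
  have hsubP : ∀ q q' : N, P q - P q' = ((q - q' : N) : E) + (ζ q - ζ q') • v := by
    intro q q'
    simp only [hP, Submodule.coe_sub, sub_smul]
    abel
  have hlP : ∀ q q' : N, l (P q - P q') = ζ q - ζ q' := by
    intro q q'
    rw [hsubP, map_add, hlN, map_smul, hv]; simp
  have hlip : ∀ q ∈ Metric.ball (0 : N) d, ∀ q' ∈ Metric.ball (0 : N) d,
      ‖ζ q - ζ q'‖ ≤ ‖q - q'‖ := by
    intro q hq q' hq'
    have h1 := hsapp (P q) (hδs (hPmem q hq)).1 (P q') (hδs (hPmem q' hq')).1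
    rw [hgh _ (hδs (hPmem q hq)).2 (hP0 q hq), hgh _ (hδs (hPmem q' hq')).2 (hP0 q' hq'), hlP,
      sub_zero, zero_sub, norm_neg, hsubP, hc0] at h1
    have h2 : ‖((q - q' : N) : E) + (ζ q - ζ q') • v‖ ≤ ‖q - q'‖ + ‖ζ q - ζ q'‖ * ‖v‖ :=
      (norm_add_le _ _).trans_eq (by rw [norm_smul]; rfl)
    have h3 : ‖ζ q - ζ q'‖ * (2 * (‖v‖ + 1)) ≤ ‖q - q'‖ + ‖ζ q - ζ q'‖ * ‖v‖ := by
      rw [one_div, inv_mul_eq_div, le_div_iff₀ (by positivity)] at h1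
      exact h1.trans h2
    nlinarith [norm_nonneg (ζ q - ζ q'), norm_nonneg v,
      mul_nonneg (norm_nonneg (ζ q - ζ q')) (norm_nonneg v)]
  have hPlip : ∀ q ∈ Metric.ball (0 : N) d, ∀ q' ∈ Metric.ball (0 : N) d,
      ‖P q - P q'‖ ≤ (1 + ‖v‖) * ‖q - q'‖ := by
    intro q hq q' hq'
    rw [hsubP]
    calc _ ≤ ‖q - q'‖ + ‖ζ q - ζ q'‖ * ‖v‖ := (norm_add_le _ _).trans_eq (by rw [norm_smul]; rfl)
      _ ≤ ‖q - q'‖ + ‖q - q'‖ * ‖v‖ := by gcongr; exact hlip q hq q' hq'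
      _ = _ := by ring
  have hder : ∀ q ∈ Metric.ball (0 : N) d, HasFDerivAt (F ∘ P) (0 : N →L[ℂ] E) q := by
    intro q hq
    have hFq : HasFDerivAt F (0 : E →L[ℂ] E) (P q) := by
      rw [← hFh _ (hδs (hPmem q hq)).2 (hP0 q hq)]
      exact (hF.differentiableAt (hU.mem_nhds (hδs (hPmem q hq)).2)).hasFDerivAt
    have hO : (fun q' => P q' - P q) =O[𝓝 q] fun q' => q' - q := by
      refine Asymptotics.IsBigO.of_bound (1 + ‖v‖) ?_
      filter_upwards [Metric.isOpen_ball.mem_nhds hq] with q' hq'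
      exact hPlip q' hq' q hq
    have hct : Tendsto P (𝓝 q) (𝓝 (P q)) := by
      have h1 : Tendsto (fun q' => q' - q) (𝓝 q) (𝓝 0) := by
        have : Continuous fun q' : N => q' - q := by fun_prop
        simpa using this.tendsto q
      simpa using (hO.trans_tendsto h1).add_const (P q)
    have h1 := (hasFDerivAt_iff_isLittleO.1 hFq).comp_tendsto hct
    rw [hasFDerivAt_iff_isLittleO]
    simpa [Function.comp_def] using h1.trans_isBigO hO
  have hconst : ∀ q ∈ Metric.ball (0 : N) d, ∀ q' ∈ Metric.ball (0 : N) d,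
      F (P q) = F (P q') := by
    intro q hq q' hq'
    refine Metric.isOpen_ball.is_const_of_fderiv_eq_zero (𝕜 := ℂ)
      (convex_ball (0 : N) d).isPreconnected (f := F ∘ P)
      (fun x hx => (hder x hx).differentiableAt.differentiableWithinAt)
      (fun x hx => (hder x hx).fderiv) hq hq'
  have hNt : Nontrivial N := by
    refine Module.nontrivial_of_finrank_pos (R := ℂ) ?_
    have := LinearMap.finrank_range_add_finrank_ker (l : E →ₗ[ℂ] ℂ)
    have h2 := Submodule.finrank_le (LinearMap.range (l : E →ₗ[ℂ] ℂ))
    rw [Module.finrank_self] at h2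
    rw [hN]
    omega
  obtain ⟨q, hq0, hq⟩ : ∃ q : N, q ≠ 0 ∧ q ∈ Metric.ball (0 : N) d := by
    obtain ⟨q, hq⟩ := exists_ne (0 : N)
    have hq0 := norm_pos_iff.2 hq
    refine ⟨((d / (2 * ‖q‖) : ℝ) : ℂ) • q, smul_ne_zero (by
      exact_mod_cast (show d / (2 * ‖q‖) ≠ 0 by positivity)) hq, ?_⟩
    rw [mem_ball_zero_iff, norm_smul, Complex.norm_real, Real.norm_of_nonneg (by positivity)]
    field_simp
    norm_num
  have h0 := Metric.mem_ball_self (x := (0 : N)) hd0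
  have hPP := hinj (hδs (hPmem q hq)).2 (hδs (hPmem 0 h0)).2 (hconst q hq 0 h0)
  have h1 := hlP q 0
  have h2 := hsubP q 0
  rw [hPP, sub_self, map_zero] at h1
  rw [hPP, ← h1] at h2
  apply hq0
  simpa using h2.symm

end Osgood

section OsgoodTheorem

variable {E : Type*} [NormedAddCommGroup E] [NormedSpace ℂ E] [FiniteDimensional ℂ E]

lemma injective_fderiv_of_ne_zero {n : ℕ} (hn : Module.finrank ℂ E = n + 1)
    (ih : ∀ (N : Submodule ℂ E), Module.finrank ℂ N = n → ∀ (V : Set N) (k : N → N), IsOpen V →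
      DifferentiableOn ℂ k V → Set.InjOn k V → ∀ y ∈ V, Function.Injective (fderiv ℂ k y))
    {F : E → E} {U : Set E} (hU : IsOpen U) (hF : DifferentiableOn ℂ F U)
    (hinj : Set.InjOn F U) {a : E} (ha : a ∈ U) (hFa : fderiv ℂ F a ≠ 0) :
    Function.Injective (fderiv ℂ F a) := by
  set A := fderiv ℂ F a with hA
  obtain ⟨w, hw⟩ : ∃ w, A w ≠ 0 := by
    by_contra! hc
    exact hFa (ContinuousLinearMap.ext hc)
  obtain ⟨l, hl⟩ := SeparatingDual.exists_ne_zero (R := ℂ) hw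
  set f' : E →L[ℂ] ℂ := l.comp A with hf'
  set N := LinearMap.ker (f' : E →ₗ[ℂ] ℂ) with hN
  set M := LinearMap.ker (l : E →ₗ[ℂ] ℂ) with hM
  have hker : ∀ φ : E →L[ℂ] ℂ, (∃ x, φ x ≠ 0) →
      Module.finrank ℂ (LinearMap.ker (φ : E →ₗ[ℂ] ℂ)) = n := by
    rintro φ ⟨x, hx⟩
    have h1 := LinearMap.finrank_range_add_finrank_ker (φ : E →ₗ[ℂ] ℂ)
    have h2 : LinearMap.range (φ : E →ₗ[ℂ] ℂ) = ⊤ :=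
      LinearMap.range_eq_top.2 (LinearMap.surjective (f := (φ : E →ₗ[ℂ] ℂ))
        fun h => hx (by simpa using congrArg (fun g => g x) h))
    rw [h2, finrank_top, Module.finrank_self] at h1
    omega
  have hNn : Module.finrank ℂ N = n := hker f' ⟨w, hl⟩
  have hMn : Module.finrank ℂ M = n := hker l ⟨_, hl⟩
  let e : M ≃L[ℂ] N := ContinuousLinearEquiv.ofFinrankEq (hMn.trans hNn.symm)
  obtain ⟨π, hπ⟩ := Submodule.ClosedComplemented.of_finiteDimensional N
  obtain ⟨pM, hpM⟩ := Submodule.ClosedComplemented.of_finiteDimensional M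
  set H : E → ℂ × N := fun x => (l (F x), π (x - a)) with hH
  set H' : E →L[ℂ] ℂ × N := f'.prod π with hH'
  have hH'inj : Function.Injective (H' : E →ₗ[ℂ] ℂ × N) := by
    refine (injective_iff_map_eq_zero _).2 fun x hx => ?_
    have h1 : f' x = 0 := congrArg Prod.fst hx
    have h2 : π x = 0 := congrArg Prod.snd hx
    have h3 := hπ ⟨x, h1⟩
    have h4 : (⟨x, h1⟩ : N) = 0 := h3.symm.trans h2
    exact congrArg Subtype.val h4
  let eH : E ≃L[ℂ] ℂ × N := (LinearEquiv.ofInjectiveOfFinrankEq (H' : E →ₗ[ℂ] ℂ × N) hH'inj (by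
    rw [Module.finrank_prod, Module.finrank_self, hNn, hn, add_comm])).toContinuousLinearEquiv
  have heH : ∀ x, eH x = H' x := fun x => rfl
  have hHd : DifferentiableOn ℂ H U :=
    (l.differentiable.comp_differentiableOn hF).prodMk (by fun_prop)
  have hHc : ContDiffAt ℂ 1 H a := contDiffAt_one_of_differentiableOn hU hHd ha
  have hFd : HasFDerivAt F A a := (hF.differentiableAt (hU.mem_nhds ha)).hasFDerivAt
  have hHf : HasFDerivAt H (eH : E →L[ℂ] ℂ × N) a := by
    have h1 : HasFDerivAt H (f'.prod π) a := by
      refine (l.hasFDerivAt.comp a hFd).prodMk ?_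
      exact π.hasFDerivAt.comp a ((hasFDerivAt_id a).sub_const a)
    exact h1
  set Gh := hHc.toOpenPartialHomeomorph H hHf (by norm_num)
  have hGc : ContDiffAt ℂ 1 Gh.symm (H a) := hHc.to_localInverse hHf (by norm_num)
  have hGa : Gh.symm (H a) = a := hHc.localInverse_apply_image hHf (by norm_num)
  have hGf : HasFDerivAt Gh.symm (eH.symm : ℂ × N →L[ℂ] E) (H a) := by
    refine Gh.hasFDerivAt_symm
      (hHc.image_mem_toOpenPartialHomeomorph_target hHf (by norm_num)) ?_
    rw [hGa]
    exact hHf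
  have hHa : H a = (l (F a), 0) := by simp [hH]
  set γ : N → E := fun y => Gh.symm (l (F a), y) with hγ
  have hι : Continuous fun y : N => ((l (F a), y) : ℂ × N) := by fun_prop
  have hev : ∀ᶠ z in 𝓝 (H a), DifferentiableAt ℂ Gh.symm z ∧ Gh.symm z ∈ U ∧
      H (Gh.symm z) = z := by
    refine (hGc.eventually (by simp)).mp ?_
    have h1 : ∀ᶠ z in 𝓝 (H a), Gh.symm z ∈ U :=
      hGc.continuousAt.eventually (by rw [hGa]; exact hU.mem_nhds ha)
    have h2 : ∀ᶠ z in 𝓝 (H a), H (Gh.symm z) = z :=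
      Gh.eventually_right_inverse (hHc.image_mem_toOpenPartialHomeomorph_target hHf (by norm_num))
    filter_upwards [h1, h2] with z hz1 hz2 hz3
    exact ⟨hz3.differentiableAt (by norm_num), hz1, hz2⟩
  rw [hHa] at hev
  obtain ⟨V, hV, hVo, hV0⟩ := mem_nhds_iff.1 ((hι.tendsto (0 : N)).eventually hev)
  have hVd : ∀ y ∈ V, DifferentiableAt ℂ γ y := fun y hy =>
    DifferentiableAt.comp (g := Gh.symm) y (hV hy).1 (by fun_prop)
  have hFM : ∀ y ∈ V, F (γ y) - F a ∈ M := by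
    intro y hy
    have := congrArg Prod.fst (hV hy).2.2
    change l (F (γ y) - F a) = 0
    rw [map_sub, sub_eq_zero]
    exact this
  set k : N → N := fun y => e (pM (F (γ y) - F a)) with hk
  have hkd : DifferentiableOn ℂ k V := by
    intro y hy
    refine DifferentiableAt.differentiableWithinAt ?_
    refine (e : M →L[ℂ] N).differentiableAt.comp y (pM.differentiableAt.comp y ?_)
    exact ((hF.differentiableAt (hU.mem_nhds (hV hy).2.1)).comp y (hVd y hy)).sub_const _
  have hkinj : Set.InjOn k V := by
    intro y hy y' hy' h
    have h1 := e.injective h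
    have h2 := hpM ⟨_, hFM y hy⟩
    have h3 := hpM ⟨_, hFM y' hy'⟩
    simp only at h2 h3
    rw [h2, h3, Subtype.mk.injEq, sub_left_inj] at h1
    have h4 : γ y = γ y' := hinj (hV hy).2.1 (hV hy').2.1 h1
    have h5 := (hV hy).2.2
    have h6 := (hV hy').2.2
    exact congrArg Prod.snd (h5.symm.trans ((congrArg H h4).trans h6))
  have hγ0 : γ 0 = a := by rw [hγ]; simp only; rw [← hHa, hGa]
  have hγ' : HasFDerivAt γ (N.subtypeL) 0 := by
    have h1 : HasFDerivAt (fun y : N => ((l (F a), y) : ℂ × N))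
        (ContinuousLinearMap.inr ℂ ℂ N) 0 := hasFDerivAt_prodMk_right _ _
    rw [hHa] at hGf
    have h2 : HasFDerivAt γ _ 0 := HasFDerivAt.comp (0 : N) hGf h1
    refine h2.congr_fderiv (ContinuousLinearMap.ext fun y => ?_)
    change eH.symm (0, y) = (y : E)
    rw [ContinuousLinearEquiv.symm_apply_eq, heH]
    exact (Prod.ext y.2 (hπ y) : H' y = (0, y)).symm
  have hk' : HasFDerivAt k ((e : M →L[ℂ] N).comp (pM.comp (A.comp N.subtypeL))) 0 := by
    refine (e : M →L[ℂ] N).hasFDerivAt.comp (0 : N) (pM.hasFDerivAt.comp (0 : N) ?_)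
    refine HasFDerivAt.sub_const _ (HasFDerivAt.comp (g := F) (0 : N) ?_ hγ')
    rw [hγ0]; exact hFd
  have hki := ih N hNn V k hVo hkd hkinj 0 hV0
  rw [hk'.fderiv] at hki
  refine (injective_iff_map_eq_zero _).2 fun v hv => ?_
  have hvN : v ∈ N := by
    change l (A v) = 0
    rw [hv, map_zero]
  have : (⟨v, hvN⟩ : N) = 0 := by
    refine (injective_iff_map_eq_zero _).1 hki _ ?_
    simp [hv]
  simpa using this

lemma differentiableOn_det_fderiv {F : E → E} {U : Set E} (hU : IsOpen U)
    (hF : DifferentiableOn ℂ F U) :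
    DifferentiableOn ℂ (fun x => LinearMap.det (fderiv ℂ F x : E →ₗ[ℂ] E)) U := by
  have b := Module.finBasis ℂ E
  have h1 : ∀ x, LinearMap.det (fderiv ℂ F x : E →ₗ[ℂ] E) =
      ∑ σ : Equiv.Perm (Fin (Module.finrank ℂ E)), (Equiv.Perm.sign σ : ℤ) •
        ∏ i, (b.repr (fderiv ℂ F x (b i))) (σ i) := by
    intro x
    rw [← LinearMap.det_toMatrix b, Matrix.det_apply]
    simp [LinearMap.toMatrix_apply, Units.smul_def]
  simp only [h1]
  refine DifferentiableOn.fun_sum fun σ _ => ?_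
  simp only [zsmul_eq_mul]
  refine DifferentiableOn.const_mul ?_ _
  have h2 : ∀ i, DifferentiableOn ℂ (fun x => b.repr (fderiv ℂ F x (b i)) (σ i)) U := fun i =>
    (LinearMap.toContinuousLinearMap (b.coord (σ i))).differentiable.comp_differentiableOn
      (differentiableOn_fderiv_apply hU hF (b i))
  refine Finset.induction_on Finset.univ (by simp) fun i s hi ih => ?_
  simp only [Finset.prod_insert hi]
  exact (h2 i).mul ih

end OsgoodTheorem

lemma not_forall_fderiv_eq_zero_of_injOn {E : Type*} [NormedAddCommGroup E] [NormedSpace ℂ E]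
    [Nontrivial E] {F : E → E} {a : E} {r : ℝ} (hr : 0 < r)
    (hF : DifferentiableOn ℂ F (Metric.ball a r)) (hinj : Set.InjOn F (Metric.ball a r)) :
    ¬ ∀ x ∈ Metric.ball a r, fderiv ℂ F x = 0 := by
  intro h
  have ha := Metric.mem_ball_self (x := a) hr
  have hc : ∀ x ∈ Metric.ball a r, x = a := fun x hx => hinj hx ha
    (Metric.isOpen_ball.is_const_of_fderiv_eq_zero (convex_ball a r).isPreconnected hF h hx ha)
  have : NeBot (𝓝[≠] a) := Module.punctured_nhds_neBot ℂ E a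
  have h2 : ∀ᶠ z in 𝓝[≠] a, z = a := by
    filter_upwards [nhdsWithin_le_nhds (Metric.ball_mem_nhds a hr)] with z hz using hc z hz
  obtain ⟨z, hz, hz'⟩ := (h2.and self_mem_nhdsWithin).exists
  exact hz' hz

universe u

/-- Osgood's theorem: the derivative of an injective holomorphic map between spaces of the same
finite dimension is injective. -/
theorem injective_fderiv_of_injOn (n : ℕ) : ∀ (E : Type u) [NormedAddCommGroup E]
    [NormedSpace ℂ E] [FiniteDimensional ℂ E], Module.finrank ℂ E = n →
    ∀ (U : Set E) (F : E → E), IsOpen U → DifferentiableOn ℂ F U → Set.InjOn F U →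
      ∀ a ∈ U, Function.Injective (fderiv ℂ F a) := by
  induction n with
  | zero =>
    intro E _ _ _ hn U F _ _ _ a _
    have := Module.finrank_zero_iff.1 hn
    exact Function.injective_of_subsingleton _
  | succ n ih =>
    intro E _ _ _ hn U F hU hF hinj a ha
    have hnt : Nontrivial E := Module.nontrivial_of_finrank_pos (R := ℂ) (by omega)
    have hstep : ∀ x ∈ U, fderiv ℂ F x ≠ 0 → Function.Injective (fderiv ℂ F x) := fun x hx =>
      injective_fderiv_of_ne_zero hn (fun N hN V k => ih N hN V k) hU hF hinj hx
    refine hstep a ha fun ha0 => ?_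
    rcases Nat.eq_zero_or_pos n with rfl | hnpos
    · let e : E ≃L[ℂ] ℂ := ContinuousLinearEquiv.ofFinrankEq (by rw [hn, Module.finrank_self])
      have hF' : HasFDerivAt F (0 : E →L[ℂ] E) (e.symm (e a)) := by
        rw [e.symm_apply_apply, ← ha0]
        exact (hF.differentiableAt (hU.mem_nhds ha)).hasFDerivAt
      refine deriv_ne_zero_of_injOn (f := fun z => e (F (e.symm z))) (U := e.symm ⁻¹' U) (a := e a)
        (hU.preimage e.symm.continuous) ?_ ?_ (by simpa using ha) ?_
      · exact e.differentiable.comp_differentiableOn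
          (hF.comp e.symm.differentiable.differentiableOn fun z hz => hz)
      · intro z hz z' hz' h
        exact e.symm.injective (hinj hz hz' (e.injective h))
      · have h1 := (e : E →L[ℂ] ℂ).hasFDerivAt.comp (e a)
          (hF'.comp (e a) (e.symm : ℂ →L[ℂ] E).hasFDerivAt)
        have h2 := h1.hasDerivAt.deriv
        simpa [Function.comp_def] using h2
    · obtain ⟨r, hr, hrU⟩ := Metric.isOpen_iff.1 hU a ha
      have hFb := hF.mono hrU
      have hdet := differentiableOn_det_fderiv Metric.isOpen_ball hFb
      have hiff : ∀ x ∈ Metric.ball a r, LinearMap.det (fderiv ℂ F x : E →ₗ[ℂ] E) = 0 →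
          fderiv ℂ F x = 0 := by
        intro x hx h0
        by_contra hne
        have := hstep x (hrU hx) hne
        have hb := LinearMap.bot_lt_ker_of_det_eq_zero h0
        exact hb.ne' (LinearMap.ker_eq_bot.2 this)
      have hb : ∃ b ∈ Metric.ball a r, LinearMap.det (fderiv ℂ F b : E →ₗ[ℂ] E) ≠ 0 := by
        by_contra! hc
        exact not_forall_fderiv_eq_zero_of_injOn hr hFb (hinj.mono hrU)
          fun x hx => hiff x hx (hc x hx)
      obtain ⟨b, hb, hb0⟩ := hb
      have hda : LinearMap.det (fderiv ℂ F a : E →ₗ[ℂ] E) = 0 := by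
        rw [ha0, ContinuousLinearMap.toLinearMap_zero, LinearMap.det_zero, hn,
          zero_pow n.succ_ne_zero]
      obtain ⟨g, hg, hgz, p, hp, hp0, hgp⟩ := exists_fderiv_ne_zero_of_zero_set hdet hda hb hb0
      exact not_injOn_of_fderiv_eq_zero_on_zero_set (by omega) Metric.isOpen_ball hFb hg hdet hgz
        hiff hp hp0 hgp (hinj.mono hrU)

section InverseMap

variable {E : Type u} [NormedAddCommGroup E] [NormedSpace ℂ E] [FiniteDimensional ℂ E]
  {F : E → E} {U : Set E}

lemma exists_hasStrictFDerivAt_equiv_of_injOn (hU : IsOpen U) (hF : DifferentiableOn ℂ F U)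
    (hinj : Set.InjOn F U) {a : E} (ha : a ∈ U) :
    ∃ e : E ≃L[ℂ] E, HasStrictFDerivAt F (e : E →L[ℂ] E) a := by
  have h := injective_fderiv_of_injOn _ E rfl U F hU hF hinj a ha
  have hs := (contDiffAt_one_of_differentiableOn hU hF ha).hasStrictFDerivAt (by norm_num)
  exact ⟨(LinearEquiv.ofInjectiveOfFinrankEq (fderiv ℂ F a : E →ₗ[ℂ] E) h
    rfl).toContinuousLinearEquiv, hs⟩

lemma isOpen_image_of_injOn (hU : IsOpen U) (hF : DifferentiableOn ℂ F U)
    (hinj : Set.InjOn F U) : IsOpen (F '' U) := by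
  rw [isOpen_iff_mem_nhds]
  rintro _ ⟨x, hx, rfl⟩
  obtain ⟨e, he⟩ := exists_hasStrictFDerivAt_equiv_of_injOn hU hF hinj hx
  rw [← he.map_nhds_eq_of_equiv]
  exact image_mem_map (hU.mem_nhds hx)

lemma differentiableOn_invFunOn_of_injOn (hU : IsOpen U) (hF : DifferentiableOn ℂ F U)
    (hinj : Set.InjOn F U) : DifferentiableOn ℂ (Function.invFunOn F U) (F '' U) := by
  rintro _ ⟨x, hx, rfl⟩
  obtain ⟨e, he⟩ := exists_hasStrictFDerivAt_equiv_of_injOn hU hF hinj hx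
  refine (he.to_local_left_inverse ?_).hasFDerivAt.differentiableAt.differentiableWithinAt
  filter_upwards [hU.mem_nhds hx] with y hy using hinj.leftInvOn_invFunOn hy

/-- If every boundary point of a closed ball is moved away from the image of the centre, then the
image of the closed ball contains a ball of the corresponding radius. -/
lemma ball_subset_image_closedBall_of_injOn (hF : DifferentiableOn ℂ F U)
    (hinj : Set.InjOn F U) {x : E} {r δ : ℝ} (hr : 0 < r) (hδ : 0 < δ)
    (hxU : Metric.closedBall x r ⊆ U) (hsph : ∀ y ∈ Metric.sphere x r, δ ≤ dist (F y) (F x)) :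
    Metric.ball (F x) δ ⊆ F '' Metric.closedBall x r := by
  have hb := Metric.ball_subset_closedBall (x := x) (ε := r)
  refine subset_trans ?_ (Set.image_mono hb)
  have := FiniteDimensional.proper ℂ E
  have : NormedSpace ℝ E := NormedSpace.complexToReal
  refine (convex_ball (F x) δ).isPreconnected.subset_of_closure_inter_subset
    (isOpen_image_of_injOn Metric.isOpen_ball (hF.mono (hb.trans hxU)) (hinj.mono (hb.trans hxU)))
    ⟨F x, Metric.mem_ball_self hδ, Set.mem_image_of_mem _ (Metric.mem_ball_self hr)⟩ ?_
  rintro y ⟨hy, hyδ⟩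
  have hcl : IsClosed (F '' Metric.closedBall x r) :=
    ((isCompact_closedBall x r).image_of_continuousOn (hF.continuousOn.mono hxU)).isClosed
  obtain ⟨z, hz, rfl⟩ := closure_minimal (Set.image_mono hb) hcl hy
  refine Set.mem_image_of_mem _ ((Metric.mem_closedBall.1 hz).lt_of_ne fun h => ?_)
  exact absurd (hsph z h) (not_le.2 hyδ)

end InverseMap

section TimeDerivative

variable {E : Type*} [NormedAddCommGroup E] [NormedSpace ℝ E]

lemma exists_time_derivative {Ω : Set E} (hΩ : IsOpen Ω) {Φ : ℝ → E → E}
    (hC1 : ContDiffOn ℝ 1 (fun p : ℝ × E => Φ p.1 p.2) (Set.Icc (0 : ℝ) 1 ×ˢ Ω)) :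
    ∃ D : ℝ → E → E, ContinuousOn (fun p : ℝ × E => D p.1 p.2) (Set.Icc (0 : ℝ) 1 ×ˢ Ω) ∧
      ∀ t ∈ Set.Icc (0 : ℝ) 1, ∀ x ∈ Ω,
        HasDerivWithinAt (fun s => Φ s x) (D t x) (Set.Icc 0 1) t := by
  set S := Set.Icc (0 : ℝ) 1 ×ˢ Ω
  have hS : UniqueDiffOn ℝ S := (uniqueDiffOn_Icc zero_lt_one).prod hΩ.uniqueDiffOn
  set f : ℝ × E → E := fun p => Φ p.1 p.2
  refine ⟨fun t x => fderivWithin ℝ f S (t, x) (1, 0), ?_, fun t ht x hx => ?_⟩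
  · exact (hC1.continuousOn_fderivWithin hS le_rfl).clm_apply continuousOn_const
  · have h1 := (hC1.differentiableOn one_ne_zero (t, x) ⟨ht, hx⟩).hasFDerivWithinAt
    have h2 : HasDerivWithinAt (fun s : ℝ => (s, x)) ((1 : ℝ), (0 : E)) (Set.Icc 0 1) t :=
      ((hasDerivAt_id t).prodMk (hasDerivAt_const t x)).hasDerivWithinAt
    have hm : Set.MapsTo (fun s : ℝ => (s, x)) (Set.Icc 0 1) S := fun s hs => ⟨hs, hx⟩
    exact h1.comp_hasDerivWithinAt t h2 hm

variable {Ω : Set E} {Φ D : ℝ → E → E}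

lemma norm_sub_sub_time_derivative_le
    (hD : ContinuousOn (fun p : ℝ × E => D p.1 p.2) (Set.Icc (0 : ℝ) 1 ×ˢ Ω))
    (hΦD : ∀ t ∈ Set.Icc (0 : ℝ) 1, ∀ x ∈ Ω,
      HasDerivWithinAt (fun s => Φ s x) (D t x) (Set.Icc 0 1) t)
    {K : Set E} (hK : IsCompact K) (hKΩ : K ⊆ Ω) {ε : ℝ} (hε : 0 < ε) :
    ∃ δ > 0, ∀ s ∈ Set.Icc (0 : ℝ) 1, ∀ t ∈ Set.Icc (0 : ℝ) 1, |s - t| < δ → ∀ x ∈ K,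
      ‖Φ s x - Φ t x - (s - t) • D t x‖ ≤ ε * |s - t| := by
  have hc : IsCompact (Set.Icc (0 : ℝ) 1 ×ˢ K) := isCompact_Icc.prod hK
  have hu := hc.uniformContinuousOn_of_continuous (hD.mono (Set.prod_mono subset_rfl hKΩ))
  obtain ⟨δ, hδ, hu⟩ := Metric.uniformContinuousOn_iff.1 hu ε hε
  refine ⟨δ, hδ, fun s hs t ht hst x hx => ?_⟩
  have hderiv : ∀ u ∈ Set.Icc (0 : ℝ) 1 ∩ Metric.ball t δ,
      HasDerivWithinAt (fun s => Φ s x - (s - t) • D t x) (D u x - D t x)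
        (Set.Icc (0 : ℝ) 1 ∩ Metric.ball t δ) u := by
    intro u hu
    have h1 := (hΦD u hu.1 x (hKΩ hx)).mono (Set.inter_subset_left (t := Metric.ball t δ))
    have h2 : HasDerivAt (fun s : ℝ => (s - t) • D t x) (D t x) u := by
      simpa using ((hasDerivAt_id u).sub_const t).smul_const (D t x)
    exact h1.sub h2.hasDerivWithinAt
  have := Convex.norm_image_sub_le_of_norm_hasDerivWithin_le (C := ε) hderiv (fun u hu' => ?_)
    ((convex_Icc 0 1).inter (convex_ball t δ)) ⟨ht, Metric.mem_ball_self hδ⟩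
    ⟨hs, by simpa [Real.dist_eq] using hst⟩
  · simpa [sub_right_comm] using this
  · rw [← dist_eq_norm]
    refine (hu (u, x) ⟨hu'.1, hx⟩ (t, x) ⟨ht, hx⟩ ?_).le
    simpa [Prod.dist_eq, hδ] using hu'.2

lemma differentiableOn_time_derivative [NormedSpace ℂ E] [IsScalarTower ℝ ℂ E]
    [FiniteDimensional ℂ E] (hΩ : IsOpen Ω)
    (hD : ContinuousOn (fun p : ℝ × E => D p.1 p.2) (Set.Icc (0 : ℝ) 1 ×ˢ Ω))
    (hΦD : ∀ t ∈ Set.Icc (0 : ℝ) 1, ∀ x ∈ Ω,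
      HasDerivWithinAt (fun s => Φ s x) (D t x) (Set.Icc 0 1) t)
    (hhol : ∀ t ∈ Set.Icc (0 : ℝ) 1, DifferentiableOn ℂ (Φ t) Ω) {t : ℝ}
    (ht : t ∈ Set.Icc (0 : ℝ) 1) : DifferentiableOn ℂ (D t) Ω := by
  intro x hx
  have := FiniteDimensional.proper ℂ E
  have := FiniteDimensional.complete ℂ E
  obtain ⟨r, hr, hrΩ⟩ := Metric.nhds_basis_closedBall.mem_iff.1 (hΩ.mem_nhds hx)
  have hb := Metric.ball_subset_closedBall (x := x) (ε := r)
  have : (𝓝[Set.Icc 0 1 \ {t}] t).NeBot := by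
    exact accPt_principal_iff_nhdsWithin.1 (uniqueDiffOn_Icc zero_lt_one t ht).accPt
  refine (differentiableAt_of_tendstoUniformlyOn_ball (l := 𝓝[Set.Icc 0 1 \ {t}] t) hr
    (f := fun s y => if s ∈ Set.Icc (0 : ℝ) 1 then (((s - t : ℝ) : ℂ))⁻¹ • (Φ s y - Φ t y) else 0)
    (fun s => ?_) ?_).differentiableWithinAt
  · by_cases hs : s ∈ Set.Icc (0 : ℝ) 1
    · simp only [hs, if_true]
      exact DifferentiableOn.const_smul (((hhol s hs).sub (hhol t ht)).mono (hb.trans hrΩ)) _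
    · simp only [hs, if_false]
      exact differentiableOn_const _
  · rw [Metric.tendstoUniformlyOn_iff]
    intro ε hε
    obtain ⟨δ, hδ, h⟩ := norm_sub_sub_time_derivative_le hD hΦD (isCompact_closedBall x r) hrΩ
      (half_pos hε)
    filter_upwards [self_mem_nhdsWithin, nhdsWithin_le_nhds (Metric.ball_mem_nhds t hδ)]
      with s hs hsδ y hy
    have hst : s - t ≠ 0 := sub_ne_zero.2 hs.2
    have key := h s hs.1 t ht (by simpa [Real.dist_eq] using hsδ) y (hb hy)
    simp only [hs.1, if_true]
    have hstC : ((s - t : ℝ) : ℂ) ≠ 0 := by exact_mod_cast hst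
    rw [dist_comm, dist_eq_norm]
    have heq : (((s - t : ℝ) : ℂ))⁻¹ • (Φ s y - Φ t y) - D t y =
        (((s - t : ℝ) : ℂ))⁻¹ • (Φ s y - Φ t y - (s - t) • D t y) := by
      rw [smul_sub _ (Φ s y - Φ t y) _, ← algebraMap_smul ℂ (s - t) (D t y), smul_smul,
        Complex.coe_algebraMap, inv_mul_cancel₀ hstC, one_smul]
    rw [heq, norm_smul, norm_inv, Complex.norm_real, Real.norm_eq_abs,
      inv_mul_lt_iff₀ (abs_pos.2 hst)]
    refine key.trans_lt ?_
    rw [mul_comm]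
    exact mul_lt_mul_of_pos_left (half_lt_self hε) (abs_pos.2 hst)

end TimeDerivative

section PolynomialField

variable {k m : ℕ}

lemma differentiable_eval_mvPolynomial (p : MvPolynomial (Fin k ⊕ Fin m) ℂ) :
    Differentiable ℂ fun y : EuclideanSpace ℂ (Fin k) × EuclideanSpace ℂ (Fin m) =>
      MvPolynomial.eval (Sum.elim (fun i => y.1 i) (fun i => y.2 i)) p := by
  induction p using MvPolynomial.induction_on with
  | C a => simp
  | add p q hp hq =>
    simp only [map_add]
    exact hp.add hq
  | mul_X p i hp =>
    simp only [map_mul, MvPolynomial.eval_X]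
    refine hp.mul ?_
    cases i with
    | inl i => simp only [Sum.elim_inl]; fun_prop
    | inr i => simp only [Sum.elim_inr]; fun_prop

lemma exists_automorphismField_approx_of_isRungeProd (hm : 2 ≤ m)
    {U K : Set (EuclideanSpace ℂ (Fin k) × EuclideanSpace ℂ (Fin m))}
    {X : EuclideanSpace ℂ (Fin k) × EuclideanSpace ℂ (Fin m) →
      EuclideanSpace ℂ (Fin k) × EuclideanSpace ℂ (Fin m)}
    (hU : IsRungeProd k m U) (hX : DifferentiableOn ℂ X U) (hX1 : ∀ y ∈ U, (X y).1 = 0)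
    (hKU : K ⊆ U) (hK : IsCompact K) {ε : ℝ} (hε : 0 < ε) :
    ∃ W ∈ automorphismFields k m, Differentiable ℂ W ∧ ∀ y ∈ K, ‖W y - X y‖ < ε := by
  set η := ε / (m + 1) with hη
  have hη0 : 0 < η := by positivity
  have hX2 : ∀ i : Fin m, DifferentiableOn ℂ (fun y => (X y).2 i) U := fun i =>
    ((EuclideanSpace.proj i : EuclideanSpace ℂ (Fin m) →L[ℂ] ℂ).comp (ContinuousLinearMap.snd ℂ
      (EuclideanSpace ℂ (Fin k)) _)).differentiable.comp_differentiableOn hX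
  choose P hP using fun i => hU _ (hX2 i) K hKU hK η hη0
  refine ⟨_, polynomial_mem_automorphismFields hm P, ?_, fun y hy => ?_⟩
  · exact Differentiable.fun_sum fun i _ => (differentiable_eval_mvPolynomial (P i)).smul_const _
  · have hXy : X y = ∑ i, (X y).2 i • verticalVector k m i := by
      refine Prod.ext ?_ ?_
      · rw [hX1 y (hKU hy), Prod.fst_sum]
        simp [verticalVector]
      · rw [Prod.snd_sum]
        ext j
        simp [verticalVector, Pi.single_apply]
    have hv : ∀ i, ‖verticalVector k m i‖ = 1 := by
      intro i
      simp [verticalVector, Prod.norm_def]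
    rw [hXy, ← Finset.sum_sub_distrib]
    calc _ ≤ ∑ i : Fin m, η := by
          refine norm_sum_le_of_le _ fun i _ => ?_
          rw [← sub_smul, norm_smul, hv, mul_one, norm_sub_rev]
          exact (hP i y hy).le
      _ = m * η := by simp
      _ < ε := by
        rw [hη, mul_div_assoc', div_lt_iff₀ (by positivity)]
        nlinarith

end PolynomialField

section LipschitzBound

variable {E : Type*} [NormedAddCommGroup E] [NormedSpace ℂ E]

lemma norm_sub_le_of_forall_mem_ball_norm_le {W : E → E} (hW : Differentiable ℂ W) {p y : E}
    {δ M : ℝ} (hδ : 0 < δ) (hM : ∀ x ∈ Metric.ball p δ, ‖W x‖ ≤ M) (hy : ‖y - p‖ ≤ δ / 2) :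
    ‖W y - W p‖ ≤ 4 * M / δ * ‖y - p‖ := by
  have : NormedSpace ℝ E := NormedSpace.complexToReal
  refine Convex.norm_image_sub_le_of_norm_fderiv_le (𝕜 := ℂ) (s := Metric.closedBall p (δ / 2))
    (fun x _ => hW x) (fun x hx => ?_) (convex_closedBall _ _)
    (Metric.mem_closedBall_self (by positivity)) (by simpa [dist_eq_norm] using hy)
  have := norm_fderiv_le_of_forall_mem_ball_norm_le (c := x) (half_pos hδ) hW.differentiableOn
    (fun z hz => hM z (Metric.ball_subset_ball' (by linarith [Metric.mem_closedBall.1 hx]) hz))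
  refine this.trans_eq ?_
  field_simp
  ring_nf

end LipschitzBound

lemma of_forall_exists_local_propagation {Q : ℝ → Prop} (h0 : Q 0)
    (h : ∀ c ∈ Set.Icc (0 : ℝ) 1, ∃ ρ > 0, ∀ s ∈ Set.Icc (0 : ℝ) 1, ∀ t ∈ Set.Icc (0 : ℝ) 1,
      |s - c| < ρ → |t - c| < ρ → s ≤ t → Q s → Q t) : Q 1 := by
  set S := {t : ℝ | t ∈ Set.Icc (0 : ℝ) 1 ∧ Q t}
  have hbdd : BddAbove S := ⟨1, fun t ht => ht.1.2⟩
  have h0S : (0 : ℝ) ∈ S := ⟨by simp, h0⟩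
  set c := sSup S
  have hc : c ∈ Set.Icc (0 : ℝ) 1 :=
    ⟨le_csSup hbdd h0S, csSup_le ⟨0, h0S⟩ fun t ht => ht.1.2⟩
  obtain ⟨ρ, hρ, hp⟩ := h c hc
  obtain ⟨s, hs, hsc⟩ := exists_lt_of_lt_csSup ⟨0, h0S⟩ (show c - ρ < c by linarith)
  have hsc' : s ≤ c := le_csSup hbdd hs
  set t := min (c + ρ / 2) 1
  have hct : c ≤ t := le_min (by linarith) hc.2
  have htm : t ∈ Set.Icc (0 : ℝ) 1 := ⟨hc.1.trans hct, min_le_right _ _⟩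
  have htc : t ≤ c + ρ / 2 := min_le_left _ _
  have hQt : Q t := hp s hs.1 t htm (by rw [abs_lt]; constructor <;> linarith)
    (by rw [abs_lt]; constructor <;> linarith) (hsc'.trans hct) hs.2
  have htle : t ≤ c := le_csSup hbdd ⟨htm, hQt⟩
  have : t = 1 := by
    rcases min_choice (c + ρ / 2) 1 with h | h
    · exact absurd htle (by rw [show t = c + ρ / 2 from h]; linarith)
    · exact h
  rwa [this] at hQt

section Propagation

variable {E : Type u} [NormedAddCommGroup E] [NormedSpace ℂ E]

lemma exists_ball_subset_image_cthickening [FiniteDimensional ℂ E] {Ω : Set E} {Φ : ℝ → E → E}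
    (hc : ContinuousOn (fun p : ℝ × E => Φ p.1 p.2) (Set.Icc (0 : ℝ) 1 ×ˢ Ω))
    (hinj : ∀ t ∈ Set.Icc (0 : ℝ) 1, Set.InjOn (Φ t) Ω)
    (hhol : ∀ t ∈ Set.Icc (0 : ℝ) 1, DifferentiableOn ℂ (Φ t) Ω) {K : Set E} (hK : IsCompact K)
    {r : ℝ} (hr : 0 < r) (hrΩ : Metric.cthickening r K ⊆ Ω) :
    ∃ δ > 0, ∀ t ∈ Set.Icc (0 : ℝ) 1, ∀ x ∈ K,
      Metric.ball (Φ t x) δ ⊆ Φ t '' Metric.cthickening r K := by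
  have := FiniteDimensional.proper ℂ E
  have hcb : ∀ x ∈ K, Metric.closedBall x r ⊆ Metric.cthickening r K := fun x hx =>
    Metric.closedBall_subset_cthickening hx r
  have hKΩ : K ⊆ Ω := fun x hx => hrΩ (hcb x hx (Metric.mem_closedBall_self hr.le))
  have hmem : ∀ x ∈ K, ∀ v ∈ Metric.sphere (0 : E) r, x + v ∈ Metric.closedBall x r := by
    intro x hx v hv
    have := mem_sphere_zero_iff_norm.1 hv
    simp [dist_eq_norm, this]
  obtain ⟨δ, hδ, h⟩ := ((isCompact_Icc (a := (0 : ℝ)) (b := 1)).prod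
    (hK.prod (isCompact_sphere (0 : E) r))).exists_forall_le'
    (f := fun q : ℝ × E × E => dist (Φ q.1 (q.2.1 + q.2.2)) (Φ q.1 q.2.1)) (a := 0) (by
      refine continuous_dist.comp_continuousOn (ContinuousOn.prodMk ?_ ?_)
      · exact hc.comp (f := fun q : ℝ × E × E => (q.1, q.2.1 + q.2.2)) (by fun_prop)
          fun q hq => ⟨hq.1, hrΩ (hcb _ hq.2.1 (hmem _ hq.2.1 _ hq.2.2))⟩
      · exact hc.comp (f := fun q : ℝ × E × E => (q.1, q.2.1)) (by fun_prop)
          fun q hq => ⟨hq.1, hKΩ hq.2.1⟩) (by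
      rintro ⟨t, x, v⟩ ⟨ht, hx, hv⟩
      refine dist_pos.2 fun h => ?_
      have := hinj t ht (hrΩ (hcb _ hx (hmem _ hx _ hv))) (hKΩ hx) h
      have hv0 : v = 0 := by simpa using this
      have := mem_sphere_zero_iff_norm.1 hv
      rw [hv0, norm_zero] at this
      exact hr.ne this)
  refine ⟨δ, hδ, fun t ht x hx => ?_⟩
  refine (ball_subset_image_closedBall_of_injOn (hhol t ht) (hinj t ht) hr hδ
    ((hcb x hx).trans hrΩ) fun y hy => ?_).trans (Set.image_mono (hcb x hx))
  have := h (t, x, y - x) ⟨ht, hx, by simpa [dist_eq_norm] using hy⟩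
  simpa using this

lemma norm_sub_le_of_euler_step {Ay y p q Wy Wp d : E} {h η e L : ℝ} (hh : 0 ≤ h)
    (hA : ‖Ay - y - (h : ℂ) • Wy‖ ≤ η / 2 * h) (hy : ‖y - p‖ ≤ e)
    (hW : ‖Wy - Wp‖ ≤ L * e) (hd : ‖Wp - d‖ ≤ η) (hq : ‖q - p - (h : ℂ) • d‖ ≤ η / 2 * h) :
    ‖Ay - q‖ ≤ (1 + L * h) * e + 2 * η * h := by
  have hsm : ∀ v : E, ‖(h : ℂ) • v‖ = h * ‖v‖ := fun v => by
    rw [norm_smul, Complex.norm_real, Real.norm_of_nonneg hh]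
  have heq : Ay - q = (Ay - y - (h : ℂ) • Wy) + (y - p) + (h : ℂ) • (Wy - Wp) +
      (h : ℂ) • (Wp - d) - (q - p - (h : ℂ) • d) := by
    simp only [smul_sub]; abel
  rw [heq]
  have h1 : h * ‖Wy - Wp‖ ≤ h * (L * e) := by gcongr
  have h2 : h * ‖Wp - d‖ ≤ h * η := by gcongr
  refine (norm_sub_le _ _).trans ?_
  refine (add_le_add ((norm_add_le _ _).trans (add_le_add ((norm_add_le _ _).trans
    (add_le_add (norm_add_le _ _) le_rfl)) le_rfl)) le_rfl).trans ?_
  rw [hsm, hsm]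
  linarith

lemma one_add_mul_mul_add_le {L η s t : ℝ} (hL : 0 ≤ L) (hη : 0 ≤ η) (hs : 0 ≤ s) (hst : s ≤ t) :
    (1 + L * (t - s)) * (2 * η * s * Real.exp (L * s)) + 2 * η * (t - s) ≤
      2 * η * t * Real.exp (L * t) := by
  have h1 : 1 + L * (t - s) ≤ Real.exp (L * (t - s)) := by
    linarith [Real.add_one_le_exp (L * (t - s))]
  have h2 : Real.exp (L * t) = Real.exp (L * (t - s)) * Real.exp (L * s) := by
    rw [← Real.exp_add]; ring_nf
  have h3 : 1 ≤ Real.exp (L * t) := Real.one_le_exp (mul_nonneg hL (hs.trans hst))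
  have h4 : 0 ≤ t - s := sub_nonneg.2 hst
  calc _ ≤ Real.exp (L * (t - s)) * (2 * η * s * Real.exp (L * s)) +
        2 * η * (t - s) * Real.exp (L * t) :=
        add_le_add (by gcongr) (le_mul_of_one_le_right (by positivity) h3)
    _ = _ := by rw [h2]; ring

end Propagation

lemma exists_automorphismField_approx_time_derivative {k m : ℕ} (hm : 2 ≤ m)
    {Ω : Set (EuclideanSpace ℂ (Fin k) × EuclideanSpace ℂ (Fin m))} (hΩ : IsOpen Ω)
    {Φ D : ℝ → EuclideanSpace ℂ (Fin k) × EuclideanSpace ℂ (Fin m) →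
      EuclideanSpace ℂ (Fin k) × EuclideanSpace ℂ (Fin m)}
    (hΦ : ContinuousOn (fun p : ℝ × (EuclideanSpace ℂ (Fin k) × EuclideanSpace ℂ (Fin m)) =>
      Φ p.1 p.2) (Set.Icc (0 : ℝ) 1 ×ˢ Ω))
    (hD : ContinuousOn (fun p : ℝ × (EuclideanSpace ℂ (Fin k) × EuclideanSpace ℂ (Fin m)) =>
      D p.1 p.2) (Set.Icc (0 : ℝ) 1 ×ˢ Ω))
    {c : ℝ} (hc : c ∈ Set.Icc (0 : ℝ) 1) (hinj : Set.InjOn (Φ c) Ω)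
    (hhol : DifferentiableOn ℂ (Φ c) Ω) (hDhol : DifferentiableOn ℂ (D c) Ω)
    (hD1 : ∀ x ∈ Ω, (D c x).1 = 0) (hRunge : IsRungeProd k m (Φ c '' Ω))
    {K : Set (EuclideanSpace ℂ (Fin k) × EuclideanSpace ℂ (Fin m))} (hK : IsCompact K)
    (hKΩ : K ⊆ Ω) {η : ℝ} (hη : 0 < η) :
    ∃ W ∈ automorphismFields k m, Differentiable ℂ W ∧ ∃ ρ > 0, ∀ t ∈ Set.Icc (0 : ℝ) 1,
      |t - c| < ρ → ∀ x ∈ K, ‖W (Φ t x) - D t x‖ ≤ η := by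
  have hinv : ∀ x ∈ Ω, Function.invFunOn (Φ c) Ω (Φ c x) = x := fun x hx =>
    hinj.leftInvOn_invFunOn hx
  have hmaps : Set.MapsTo (Function.invFunOn (Φ c) Ω) (Φ c '' Ω) Ω := by
    rintro _ ⟨x, hx, rfl⟩
    rwa [hinv x hx]
  obtain ⟨W, hWA, hWd, hW⟩ := exists_automorphismField_approx_of_isRungeProd hm hRunge
    (X := D c ∘ Function.invFunOn (Φ c) Ω) (K := Φ c '' K)
    (hDhol.comp (differentiableOn_invFunOn_of_injOn hΩ hhol hinj) hmaps)
    (fun y hy => hD1 _ (hmaps hy)) (Set.image_mono hKΩ)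
    (hK.image_of_continuousOn (hhol.continuousOn.mono hKΩ)) (half_pos hη)
  refine ⟨W, hWA, hWd, ?_⟩
  have hsub : Set.Icc (0 : ℝ) 1 ×ˢ K ⊆ Set.Icc (0 : ℝ) 1 ×ˢ Ω := Set.prod_mono subset_rfl hKΩ
  have hu := (isCompact_Icc.prod hK).uniformContinuousOn_of_continuous
    ((hWd.continuous.comp_continuousOn (hΦ.mono hsub)).sub (hD.mono hsub))
  obtain ⟨ρ, hρ, hu⟩ := Metric.uniformContinuousOn_iff.1 hu (η / 2) (half_pos hη)
  refine ⟨ρ, hρ, fun t ht htc x hx => ?_⟩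
  have h1 := hu (t, x) ⟨ht, hx⟩ (c, x) ⟨hc, hx⟩
    (by simpa [Prod.dist_eq, Real.dist_eq, hρ] using htc)
  have h2 := hW _ (Set.mem_image_of_mem _ hx)
  simp only [Function.comp_apply, hinv x (hKΩ hx)] at h2
  rw [dist_eq_norm] at h1
  have h3 := norm_sub_norm_le (W (Φ t x) - D t x) (W (Φ c x) - D c x)
  have h4 : ‖W (Φ t x) - D t x - (W (Φ c x) - D c x)‖ < η / 2 := h1
  linarith

lemma exists_isFiberAutomorphism_step {k m : ℕ} (hm : 2 ≤ m)
    {Ω : Set (EuclideanSpace ℂ (Fin k) × EuclideanSpace ℂ (Fin m))} (hΩ : IsOpen Ω)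
    {Φ D : ℝ → EuclideanSpace ℂ (Fin k) × EuclideanSpace ℂ (Fin m) →
      EuclideanSpace ℂ (Fin k) × EuclideanSpace ℂ (Fin m)}
    (hΦ : ContinuousOn (fun p : ℝ × (EuclideanSpace ℂ (Fin k) × EuclideanSpace ℂ (Fin m)) =>
      Φ p.1 p.2) (Set.Icc (0 : ℝ) 1 ×ˢ Ω))
    (hD : ContinuousOn (fun p : ℝ × (EuclideanSpace ℂ (Fin k) × EuclideanSpace ℂ (Fin m)) =>
      D p.1 p.2) (Set.Icc (0 : ℝ) 1 ×ˢ Ω))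
    (hΦD : ∀ t ∈ Set.Icc (0 : ℝ) 1, ∀ x ∈ Ω,
      HasDerivWithinAt (fun s => Φ s x) (D t x) (Set.Icc 0 1) t)
    {c : ℝ} (hc : c ∈ Set.Icc (0 : ℝ) 1) (hinj : Set.InjOn (Φ c) Ω)
    (hhol : DifferentiableOn ℂ (Φ c) Ω) (hDhol : DifferentiableOn ℂ (D c) Ω)
    (hD1 : ∀ x ∈ Ω, (D c x).1 = 0) (hRunge : IsRungeProd k m (Φ c '' Ω))
    {K K' : Set (EuclideanSpace ℂ (Fin k) × EuclideanSpace ℂ (Fin m))} (hKK' : K ⊆ K')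
    (hK : IsCompact K) (hK' : IsCompact K') (hK'Ω : K' ⊆ Ω) {δ M η : ℝ} (hδ : 0 < δ)
    (hball : ∀ t ∈ Set.Icc (0 : ℝ) 1, ∀ x ∈ K, Metric.ball (Φ t x) δ ⊆ Φ t '' K')
    (hM : ∀ t ∈ Set.Icc (0 : ℝ) 1, ∀ x ∈ K', ‖D t x‖ ≤ M) (hη : 0 < η) (hη1 : η ≤ 1) :
    ∃ ρ > 0, ∀ s ∈ Set.Icc (0 : ℝ) 1, ∀ t ∈ Set.Icc (0 : ℝ) 1, |s - c| < ρ → |t - c| < ρ → s ≤ t →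
      ∀ Ψ, IsFiberAutomorphism Ψ → ∀ e ≤ δ / 2, (∀ x ∈ K, ‖Ψ x - Φ s x‖ ≤ e) →
        ∃ Ψ' : EuclideanSpace ℂ (Fin k) × EuclideanSpace ℂ (Fin m) →
          EuclideanSpace ℂ (Fin k) × EuclideanSpace ℂ (Fin m), IsFiberAutomorphism Ψ' ∧
          ∀ x ∈ K, ‖Ψ' x - Φ t x‖ ≤ (1 + 4 * (M + 1) / δ * (t - s)) * e + 2 * η * (t - s) := by
  have hKΩ := hKK'.trans hK'Ω
  obtain ⟨W, ⟨-, A, hA, hAW⟩, hWd, ρ₁, hρ₁, hW⟩ := exists_automorphismField_approx_time_derivative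
    hm hΩ hΦ hD hc hinj hhol hDhol hD1 hRunge hK' hK'Ω hη
  obtain ⟨R, hR⟩ := (isCompact_Icc.prod hK).exists_bound_of_continuousOn
    (hΦ.mono (Set.prod_mono subset_rfl hKΩ))
  obtain ⟨r, hr, hAr⟩ := hAW (R + δ / 2) (η / 2) (half_pos hη)
  obtain ⟨δ₂, hδ₂, hΦδ⟩ := norm_sub_sub_time_derivative_le hD hΦD hK hKΩ (half_pos hη)
  refine ⟨min ρ₁ (min (r / 2) (δ₂ / 2)), by positivity,
    fun s hs t ht hsc htc hst Ψ hΨ e he hΨe => ⟨A ((t - s : ℝ) : ℂ) ∘ Ψ, (hA _).comp hΨ,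
      fun x hx => ?_⟩⟩
  have hts : 0 ≤ t - s := sub_nonneg.2 hst
  have hlt : t - s < r ∧ t - s < δ₂ := by
    have h1 := abs_lt.1 (hsc.trans_le ((min_le_right _ _).trans (min_le_left _ _)))
    have h2 := abs_lt.1 (htc.trans_le ((min_le_right _ _).trans (min_le_left _ _)))
    have h3 := abs_lt.1 (hsc.trans_le ((min_le_right _ _).trans (min_le_right _ _)))
    have h4 := abs_lt.1 (htc.trans_le ((min_le_right _ _).trans (min_le_right _ _)))
    constructor <;> linarith
  have hWs := hW s hs (hsc.trans_le (min_le_left _ _))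
  have hnorm : ‖((t - s : ℝ) : ℂ)‖ = t - s := by
    rw [Complex.norm_real, Real.norm_of_nonneg hts]
  have hy := hΨe x hx
  have hM' : ∀ y ∈ Metric.ball (Φ s x) δ, ‖W y‖ ≤ M + 1 := by
    intro y hy
    obtain ⟨x', hx', rfl⟩ := hball s hs x hx hy
    have h1 := hWs x' hx'
    have h2 := norm_sub_norm_le (W (Φ s x')) (D s x')
    linarith [hM s hs x' hx']
  have hM0 : 0 ≤ M + 1 := (norm_nonneg _).trans (hM' _ (Metric.mem_ball_self hδ))
  refine norm_sub_le_of_euler_step (p := Φ s x) (Wy := W (Ψ x)) (Wp := W (Φ s x)) (d := D s x)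
    hts ?_ hy ?_ (hWs x (hKK' hx)) ?_
  · have h := hAr ((t - s : ℝ) : ℂ) (by rw [hnorm]; exact hlt.1) (Ψ x) ?_
    · rwa [hnorm] at h
    · have h1 := hR (s, x) ⟨hs, hx⟩
      have h2 := norm_sub_norm_le (Ψ x) (Φ s x)
      simp only at h1
      linarith
  · refine (norm_sub_le_of_forall_mem_ball_norm_le hWd hδ hM' (hy.trans he)).trans ?_
    gcongr
  · have h := hΦδ t ht s hs (by rw [abs_of_nonneg hts]; exact hlt.2) x hx
    rwa [abs_of_nonneg hts, ← algebraMap_smul ℂ (t - s), Complex.coe_algebraMap] at h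

end

/-- Parametric Andersén–Lempert theorem (Kutzschebauch): a C¹ isotopy of injective holomorphic
fibre-preserving maps Φ_t(z,w) = (z, φ_t(z,w)) with Runge images, starting at the identity,
can be approximated uniformly on compacts by holomorphic automorphisms of the same form. -/
theorem parametric_andersen_lempert (k m : ℕ) (hm : 2 ≤ m)
    (Ω : Set (EuclideanSpace ℂ (Fin k) × EuclideanSpace ℂ (Fin m))) (hΩopen : IsOpen Ω)
    (Φ : ℝ → EuclideanSpace ℂ (Fin k) × EuclideanSpace ℂ (Fin m) →
         EuclideanSpace ℂ (Fin k) × EuclideanSpace ℂ (Fin m))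
    (hC1 : ContDiffOn ℝ 1
      (fun p : ℝ × (EuclideanSpace ℂ (Fin k) × EuclideanSpace ℂ (Fin m)) => Φ p.1 p.2)
      (Set.Icc (0 : ℝ) 1 ×ˢ Ω))
    (hform : ∀ t ∈ Set.Icc (0 : ℝ) 1, ∀ zw ∈ Ω, (Φ t zw).1 = zw.1)
    (hinj : ∀ t ∈ Set.Icc (0 : ℝ) 1, Set.InjOn (Φ t) Ω)
    (hhol : ∀ t ∈ Set.Icc (0 : ℝ) 1, DifferentiableOn ℂ (Φ t) Ω)
    (h0 : ∀ zw ∈ Ω, Φ 0 zw = zw)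
    (hRunge : ∀ t ∈ Set.Icc (0 : ℝ) 1, IsRungeProd k m (Φ t '' Ω)) :
    ∀ K : Set (EuclideanSpace ℂ (Fin k) × EuclideanSpace ℂ (Fin m)), K ⊆ Ω → IsCompact K →
      ∀ ε : ℝ, 0 < ε →
        ∃ Ψ : EuclideanSpace ℂ (Fin k) × EuclideanSpace ℂ (Fin m) →
              EuclideanSpace ℂ (Fin k) × EuclideanSpace ℂ (Fin m),
          IsHolomorphicAutomorphismProd Ψ ∧ (∀ zw, (Ψ zw).1 = zw.1) ∧
          ∀ zw ∈ K, ‖Ψ zw - Φ 1 zw‖ < ε := by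
  intro K hKΩ hK ε hε
  obtain ⟨D, hD, hΦD⟩ := exists_time_derivative hΩopen hC1
  have hD1 : ∀ t ∈ Set.Icc (0 : ℝ) 1, ∀ x ∈ Ω, (D t x).1 = 0 := by
    intro t ht x hx
    have h1 := (ContinuousLinearMap.fst ℝ (EuclideanSpace ℂ (Fin k))
      (EuclideanSpace ℂ (Fin m))).hasFDerivAt.comp_hasDerivWithinAt t (hΦD t ht x hx)
    have h2 : HasDerivWithinAt (fun _ : ℝ => x.1) (D t x).1 (Set.Icc 0 1) t :=
      h1.congr (fun s hs => (hform s hs x hx).symm) (hform t ht x hx).symm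
    exact (uniqueDiffOn_Icc zero_lt_one t ht).eq_deriv _ h2 (hasDerivWithinAt_const t _ x.1)
  obtain ⟨r, hr, hrΩ⟩ := hK.exists_cthickening_subset_open hΩopen hKΩ
  have hK' : IsCompact (Metric.cthickening r K) := hK.cthickening
  obtain ⟨δ, hδ, hball⟩ := exists_ball_subset_image_cthickening hC1.continuousOn hinj hhol hK hr hrΩ
  obtain ⟨M, hM⟩ := (isCompact_Icc.prod hK').exists_bound_of_continuousOn
    (hD.mono (Set.prod_mono subset_rfl hrΩ))
  set L := 4 * (|M| + 1) / δ
  have hL : 0 ≤ L := by positivity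
  set η := min 1 (min (δ / 2) (ε / 2) / (2 * Real.exp L))
  have hη : 0 < η := by positivity
  have hbound : ∀ t ∈ Set.Icc (0 : ℝ) 1, 2 * η * t * Real.exp (L * t) ≤ min (δ / 2) (ε / 2) := by
    intro t ht
    have h1 : 2 * η * t * Real.exp (L * t) ≤ 2 * η * 1 * Real.exp (L * 1) := by
      have := ht.2
      have := ht.1
      gcongr
    have h2 : η * (2 * Real.exp L) ≤ min (δ / 2) (ε / 2) :=
      (le_div_iff₀ (by positivity)).1 (min_le_right _ _)
    rw [mul_one, mul_one] at h1
    linarith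
  obtain ⟨Ψ, hΨ, hΨK⟩ := of_forall_exists_local_propagation
    (Q := fun t => ∃ Ψ : EuclideanSpace ℂ (Fin k) × EuclideanSpace ℂ (Fin m) →
      EuclideanSpace ℂ (Fin k) × EuclideanSpace ℂ (Fin m), IsFiberAutomorphism Ψ ∧
      ∀ x ∈ K, ‖Ψ x - Φ t x‖ ≤ 2 * η * t * Real.exp (L * t))
    ⟨id, ⟨isHolomorphicAutomorphismProd_id, fun _ => rfl⟩, fun x hx => by simp [h0 x (hKΩ hx)]⟩
    (fun c hc => by
      obtain ⟨ρ, hρ, hstep⟩ := exists_isFiberAutomorphism_step hm hΩopen hC1.continuousOn hD hΦD hc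
        (hinj c hc) (hhol c hc) (differentiableOn_time_derivative hΩopen hD hΦD hhol hc) (hD1 c hc)
        (hRunge c hc) (Metric.self_subset_cthickening K) hK hK' hrΩ hδ hball
        (fun t ht x hx => (hM (t, x) ⟨ht, hx⟩).trans (le_abs_self M)) hη (min_le_left _ _)
      refine ⟨ρ, hρ, fun s hs t ht hsc htc hst ⟨Ψ, hΨ, hΨs⟩ => ?_⟩
      obtain ⟨Ψ', hΨ', h⟩ := hstep s hs t ht hsc htc hst Ψ hΨ _
        ((hbound s hs).trans (min_le_left _ _)) hΨs
      exact ⟨Ψ', hΨ', fun x hx => (h x hx).trans (one_add_mul_mul_add_le hL hη.le hs.1 hst)⟩)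
  refine ⟨Ψ, hΨ.1, hΨ.2, fun x hx => ?_⟩
  have := (hΨK x hx).trans ((hbound 1 (by simp)).trans (min_le_right _ _))
  linarith
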